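/- arXiv:2601.03060 — 8 statements merged into one kernel-verified Lean document; each statement's English description precedes it below -/
import Mathlib

section
/- For every α > 0 and every continuously differentiable function u : ℝ² → ℝ with ∫_{ℝ²} u² dx < ∞ and ∫_{ℝ²} |∇u|² dx < ∞, the integral ∫_{ℝ²} ( e^{α u(x)²} − 1 ) dx is finite. -/
open MeasureTheory Real

lemma aux_amgm (n : ℕ) (hn : 0 < n) (a : ℕ → ℝ) (ha : ∀ i, 0 ≤ a i) :
    ∏ i ∈ Finset.range n, a i ≤ ((∑ i ∈ Finset.range n, a i) / n) ^ n := by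
  have hn' : (0:ℝ) < n := by exact_mod_cast hn
  have h := Real.geom_mean_le_arith_mean (Finset.range n) (fun _ => 1) a (by simp)
    (by simpa using hn) (fun i _ => ha i)
  simp only [Real.rpow_one, Finset.sum_const, Finset.card_range, nsmul_eq_mul, mul_one,
    one_mul] at h
  have hp : 0 ≤ ∏ i ∈ Finset.range n, a i := Finset.prod_nonneg fun i _ => ha i
  have := pow_le_pow_left₀ (by positivity) h n
  rwa [← Real.rpow_natCast (_ ^ _), ← Real.rpow_mul hp, inv_mul_cancel₀ hn'.ne', Real.rpow_one]
    at this

lemma aux_iter (M F : ℝ → ℝ) (A T : ℝ) (hT : 0 < T) (hA : 0 ≤ A) (hM : ∀ t, 0 ≤ M t)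
    (hF : ∀ t, 0 ≤ F t) (hFm : Antitone F)
    (H : ∀ t h, 0 < t → 0 < h → h ^ 2 * M (t + h) ≤ A * (F t - F (t + h)) * M t)
    (m : ℕ) (hm : 0 < m) : M (T + m) ≤ (A * F T) ^ (m ^ 2) * M T := by
  have hm' : (0:ℝ) < m := by exact_mod_cast hm
  set a : ℕ → ℝ := fun j => A * m ^ 2 * (F (T + j / m) - F (T + (j + 1 : ℕ) / m)) with ha
  have ha0 : ∀ j, 0 ≤ a j := fun j => by
    have : F (T + (j + 1 : ℕ) / m) ≤ F (T + j / m) := hFm (by gcongr; simp)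
    have := sub_nonneg.2 this
    simp only [ha]; positivity
  have key : ∀ n : ℕ, M (T + n / m) ≤ (∏ j ∈ Finset.range n, a j) * M T := by
    intro n
    induction n with
    | zero => simp
    | succ n ih =>
      have h1 := H (T + n / m) (1 / m) (by positivity) (by positivity)
      have e : T + (n:ℝ) / m + 1 / m = T + ((n + 1 : ℕ) : ℝ) / m := by push_cast; ring
      rw [e] at h1
      have h2 : M (T + ((n + 1 : ℕ) : ℝ) / m) ≤ a n * M (T + n / m) := by
        have := mul_le_mul_of_nonneg_left h1 (sq_nonneg (m:ℝ))
        have e2 : (m:ℝ) ^ 2 * ((1 / m) ^ 2 * M (T + ((n + 1 : ℕ) : ℝ) / m))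
          = M (T + ((n + 1 : ℕ) : ℝ) / m) := by field_simp
        rw [e2] at this
        refine this.trans (le_of_eq ?_)
        simp only [ha]; ring
      rw [Finset.prod_range_succ]
      calc _ ≤ _ := h2
        _ ≤ a n * ((∏ j ∈ Finset.range n, a j) * M T) := by gcongr; exact ha0 n
        _ = _ := by ring
  have h3 := key (m ^ 2)
  have e3 : T + ((m ^ 2 : ℕ) : ℝ) / m = T + m := by push_cast; field_simp
  rw [e3] at h3
  refine h3.trans (mul_le_mul_of_nonneg_right ?_ (hM T))
  refine (aux_amgm (m ^ 2) (by positivity) a ha0).trans ?_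
  have hs : ∑ i ∈ Finset.range (m ^ 2), a i = A * m ^ 2 * (F T - F (T + m)) := by
    simp only [ha]
    rw [← Finset.mul_sum, Finset.sum_range_sub' (fun j : ℕ => F (T + (j:ℝ) / m))]
    rw [e3]; simp
  have hs0 : 0 ≤ ∑ i ∈ Finset.range (m ^ 2), a i := Finset.sum_nonneg fun i _ => ha0 i
  refine pow_le_pow_left₀ (by positivity) ?_ _
  rw [hs]; push_cast
  rw [div_le_iff₀ (by positivity)]
  have := mul_nonneg (mul_nonneg hA (sq_nonneg (m:ℝ))) (hF (T + m))
  nlinarith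

lemma aux_deriv : ∃ K : ℝ, 0 < K ∧ (∀ s, |deriv smoothTransition s| ≤ K) ∧
    (∀ s, s ≤ 0 → deriv smoothTransition s = 0) ∧ (∀ s, 1 ≤ s → deriv smoothTransition s = 0) := by
  have hc : ContDiff ℝ 1 smoothTransition := smoothTransition.contDiff (n := 1)
  have h0 : ∀ s, s ≤ 0 → deriv smoothTransition s = 0 := fun s hs => by
    apply IsLocalMin.deriv_eq_zero
    refine Filter.Eventually.of_forall fun y => ?_
    rw [smoothTransition.zero_of_nonpos hs]; exact smoothTransition.nonneg y
  have h1 : ∀ s, 1 ≤ s → deriv smoothTransition s = 0 := fun s hs => by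
    apply IsLocalMax.deriv_eq_zero
    refine Filter.Eventually.of_forall fun y => ?_
    rw [smoothTransition.one_of_one_le hs]; exact smoothTransition.le_one y
  obtain ⟨K, hK⟩ := (isCompact_Icc (a := (0:ℝ)) (b := 1)).exists_bound_of_continuousOn
    (hc.continuous_deriv le_rfl).continuousOn
  refine ⟨max K 1, by positivity, fun s => ?_, h0, h1⟩
  by_cases hs : s ≤ 0
  · rw [h0 s hs]; simp
  by_cases hs' : 1 ≤ s
  · rw [h1 s hs']; simp
  push Not at hs hs'
  exact (hK s ⟨hs.le, hs'.le⟩).trans (le_max_left _ _)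

lemma aux_cs {X : Type*} [MeasurableSpace X] (μ : Measure X) [IsFiniteMeasure μ] (g : X → ℝ)
    (hg0 : ∀ x, 0 ≤ g x)
    (hgm : AEStronglyMeasurable g μ) (hg2 : Integrable (fun x => g x ^ 2) μ) :
    (∫ x, g x ∂μ) ^ 2 ≤ (∫ x, g x ^ 2 ∂μ) * μ.real Set.univ := by
  have hm : MemLp g 2 μ := (memLp_two_iff_integrable_sq hgm).2 hg2
  have h := integral_mul_le_Lp_mul_Lq_of_nonneg (μ := μ) Real.HolderConjugate.two_two
    (f := g) (g := fun _ => (1:ℝ)) (.of_forall hg0) (.of_forall fun _ => zero_le_one)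
    (by simpa using hm) (memLp_const _)
  simp only [mul_one, one_pow, integral_const, smul_eq_mul, rpow_two] at h
  rw [← Real.sqrt_eq_rpow, ← Real.sqrt_eq_rpow] at h
  have h2 := pow_le_pow_left₀ (integral_nonneg hg0) h 2
  rwa [mul_pow, Real.sq_sqrt (integral_nonneg fun x => sq_nonneg _),
    Real.sq_sqrt measureReal_nonneg] at h2

lemma aux_fd (v : EuclideanSpace ℝ (Fin 2) → ℝ) (hv : ContDiff ℝ 1 v)
    (hvc : HasCompactSupport v) : Integrable (fderiv ℝ v) ∧
    Integrable (fun x => ‖fderiv ℝ v x‖ ^ 2) := by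
  have hc' : Continuous (fderiv ℝ v) := hv.continuous_fderiv one_ne_zero
  have h1 : HasCompactSupport (fderiv ℝ v) := hvc.fderiv (𝕜 := ℝ)
  have h2 : HasCompactSupport (fun x => ‖fderiv ℝ v x‖) := h1.norm
  have h3 : HasCompactSupport (fun x => ‖fderiv ℝ v x‖ ^ 2) :=
    h2.comp_left (g := fun y : ℝ => y ^ 2) (by simp)
  exact ⟨hc'.integrable_of_hasCompactSupport h1,
    (hc'.norm.pow 2).integrable_of_hasCompactSupport h3⟩

lemma aux_gns : ∃ C : ℝ, 0 ≤ C ∧ ∀ f : EuclideanSpace ℝ (Fin 2) → ℝ, ContDiff ℝ 1 f →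
    HasCompactSupport f → ∫ x, f x ^ 2 ≤ C * (∫ x, ‖fderiv ℝ f x‖) ^ 2 := by
  have hp : Real.HolderConjugate (Module.finrank ℝ (EuclideanSpace ℝ (Fin 2))) 2 := by
    simpa using Real.HolderConjugate.two_two
  refine ⟨lintegralPowLePowLIntegralFDerivConst
    (volume : Measure (EuclideanSpace ℝ (Fin 2))) 2, NNReal.coe_nonneg _, fun f hf hfc => ?_⟩
  have h := lintegral_pow_le_pow_lintegral_fderiv volume hf hfc hp
  have hc' : Continuous (fderiv ℝ f) := hf.continuous_fderiv one_ne_zero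
  have hi : Integrable (fderiv ℝ f) := (aux_fd f hf hfc).1
  have e1 : ∫ x, f x ^ 2 = (∫⁻ x, ‖f x‖ₑ ^ (2:ℝ)).toReal := by
    rw [integral_eq_lintegral_of_nonneg_ae (.of_forall fun x => sq_nonneg _)
      (hf.continuous.pow 2).aestronglyMeasurable]
    congr 2; ext x
    rw [ENNReal.rpow_two, Real.enorm_eq_ofReal_abs, ← ENNReal.ofReal_pow (abs_nonneg _), sq_abs]
  have e2 : ∫ x, ‖fderiv ℝ f x‖ = (∫⁻ x, ‖fderiv ℝ f x‖ₑ).toReal :=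
    integral_norm_eq_lintegral_enorm hi.1
  rw [e1, e2]
  have hfin : ∫⁻ x, ‖fderiv ℝ f x‖ₑ ≠ ⊤ := hi.2.ne
  have := ENNReal.toReal_mono (by finiteness) h
  simpa using this

set_option maxHeartbeats 1000000 in
lemma aux_step : ∃ A : ℝ, 0 ≤ A ∧ ∀ v : EuclideanSpace ℝ (Fin 2) → ℝ, ContDiff ℝ 1 v →
    HasCompactSupport v → ∀ t h : ℝ, 0 < t → 0 < h →
    h ^ 2 * volume.real {x | t + h ≤ v x} ≤
      A * ((∫ x in {x | t ≤ v x}, ‖fderiv ℝ v x‖ ^ 2)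
        - ∫ x in {x | t + h ≤ v x}, ‖fderiv ℝ v x‖ ^ 2) * volume.real {x | t ≤ v x} := by
  obtain ⟨C, hC, hgns⟩ := aux_gns
  obtain ⟨K, hK, hKb, hd0, hd1⟩ := aux_deriv
  refine ⟨C * K ^ 2, by positivity, fun v hv hvc t h ht hh => ?_⟩
  set S : Set (EuclideanSpace ℝ (Fin 2)) := {x | t ≤ v x} with hS
  set S' : Set (EuclideanSpace ℝ (Fin 2)) := {x | t + h ≤ v x} with hS'
  have hSm : MeasurableSet S := (isClosed_le continuous_const hv.continuous).measurableSet
  have hSm' : MeasurableSet S' := (isClosed_le continuous_const hv.continuous).measurableSet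
  have hsub : S' ⊆ S := fun x hx => by simp only [hS, hS', Set.mem_ofPred_eq] at *; linarith
  have hSfin : volume S ≠ ⊤ := by
    refine ((measure_mono ?_).trans_lt hvc.isCompact.measure_lt_top).ne
    intro x hx
    apply subset_tsupport
    simp only [hS, Set.mem_ofPred_eq, Function.mem_support] at *
    linarith
  have hc' : Continuous (fderiv ℝ v) := hv.continuous_fderiv one_ne_zero
  have hg2 : Integrable (fun x => ‖fderiv ℝ v x‖ ^ 2) := (aux_fd v hv hvc).2
  have hg1 : Integrable (fun x => ‖fderiv ℝ v x‖) :=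
    (aux_fd v hv hvc).1.norm
  rw [← setIntegral_sdiff₀ hSm'.nullMeasurableSet hg2.integrableOn hsub]
  have hBm : MeasurableSet (S \ S') := hSm.diff hSm'
  have hBfin : volume (S \ S') ≠ ⊤ := ((measure_mono Set.sdiff_subset).trans_lt hSfin.lt_top).ne
  have hψ : ContDiff ℝ 1 smoothTransition := smoothTransition.contDiff (n := 1)
  set f : EuclideanSpace ℝ (Fin 2) → ℝ := fun x => smoothTransition ((v x - t) / h) with hf
  have hfC : ContDiff ℝ 1 f := hψ.comp ((hv.sub contDiff_const).div_const h)
  have hfc : HasCompactSupport f := by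
    refine hvc.comp_left (g := fun y => smoothTransition ((y - t) / h)) ?_
    apply smoothTransition.zero_of_nonpos
    apply div_nonpos_of_nonpos_of_nonneg <;> linarith
  have hfd : ∀ x, fderiv ℝ f x = (deriv smoothTransition ((v x - t) / h) / h) • fderiv ℝ v x := by
    intro x
    have h1 : HasFDerivAt v (fderiv ℝ v x) x := (hv.differentiable one_ne_zero x).hasFDerivAt
    have h2 : HasDerivAt (fun y : ℝ => smoothTransition ((y - t) / h))
        (deriv smoothTransition ((v x - t) / h) * (1 / h)) (v x) := by
      have h3 : HasDerivAt (fun y : ℝ => (y - t) / h) (1 / h) (v x) :=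
        ((hasDerivAt_id (v x)).sub_const t).div_const h
      exact HasDerivAt.comp (v x)
        (hψ.differentiable one_ne_zero ((v x - t) / h)).hasDerivAt h3
    have h4 : HasFDerivAt f _ x := h2.comp_hasFDerivAt x h1
    rw [h4.fderiv]
    congr 1; ring
  have hI : ∫ x, ‖fderiv ℝ f x‖ ≤ (K / h) * ∫ x in S \ S', ‖fderiv ℝ v x‖ := by
    rw [← integral_const_mul, ← integral_indicator hBm]
    refine integral_mono ?_ ?_ ?_
    · exact (aux_fd f hfC hfc).1.norm
    · exact (hg1.const_mul _).indicator hBm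
    intro x
    simp only [hfd x, norm_smul]
    by_cases hx : x ∈ S \ S'
    · rw [Set.indicator_of_mem hx, norm_div, Real.norm_eq_abs, Real.norm_eq_abs, abs_of_pos hh]
      gcongr
      exact hKb _
    · rw [Set.indicator_of_notMem hx]
      have : deriv smoothTransition ((v x - t) / h) = 0 := by
        by_cases hxS : x ∈ S
        · apply hd1
          have : x ∈ S' := by by_contra hn; exact hx ⟨hxS, hn⟩
          simp only [hS', Set.mem_ofPred_eq] at this
          rw [le_div_iff₀ hh]; linarith
        · apply hd0
          simp only [hS, Set.mem_ofPred_eq, not_le] at hxS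
          apply div_nonpos_of_nonpos_of_nonneg <;> linarith
      simp [this]
  have hcs := by
    haveI : IsFiniteMeasure (volume.restrict (S \ S')) := ⟨by simpa using hBfin.lt_top⟩
    exact aux_cs (volume.restrict (S \ S')) (fun x => ‖fderiv ℝ v x‖) (fun x => norm_nonneg _)
      hg1.1.restrict hg2.integrableOn
  have hB : (volume.restrict (S \ S')).real Set.univ ≤ volume.real S := by
    rw [measureReal_restrict_apply_univ]
    exact measureReal_mono Set.sdiff_subset hSfin
  have hlow : volume.real S' ≤ ∫ x, f x ^ 2 := by
    have : volume.real S' = ∫ x, S'.indicator (fun _ => (1:ℝ)) x := by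
      rw [integral_indicator hSm']; simp
    rw [this]
    refine integral_mono_of_nonneg (.of_forall fun x => Set.indicator_nonneg (by simp) x) ?_
      (.of_forall fun x => ?_)
    · have hf2 : HasCompactSupport (fun x => f x ^ 2) :=
        hfc.comp_left (g := fun y : ℝ => y ^ 2) (by simp)
      exact (hfC.continuous.pow 2).integrable_of_hasCompactSupport hf2
    · by_cases hx : x ∈ S'
      · simp only [Set.indicator_of_mem hx, hf]
        rw [smoothTransition.one_of_one_le]
        · simp
        simp only [hS', Set.mem_ofPred_eq] at hx
        rw [le_div_iff₀ hh]; linarith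
      · simp only [Set.indicator_of_notMem hx]; positivity
  have hI0 : 0 ≤ ∫ x, ‖fderiv ℝ f x‖ := integral_nonneg fun x => norm_nonneg _
  have hG0 : 0 ≤ ∫ x in S \ S', ‖fderiv ℝ v x‖ ^ 2 := integral_nonneg fun x => by positivity
  calc h ^ 2 * volume.real S' ≤ h ^ 2 * (C * ((K / h) * ∫ x in S \ S', ‖fderiv ℝ v x‖) ^ 2) := by
        gcongr
        refine hlow.trans ((hgns f hfC hfc).trans ?_)
        gcongr
    _ = C * K ^ 2 * (∫ x in S \ S', ‖fderiv ℝ v x‖) ^ 2 := by field_simp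
    _ ≤ C * K ^ 2 * ((∫ x in S \ S', ‖fderiv ℝ v x‖ ^ 2) * volume.real S) := by
        gcongr
        exact hcs.trans (by gcongr)
    _ = _ := by ring

lemma aux_cutoff : ∃ K : ℝ, 0 ≤ K ∧ ∀ n : ℕ, ∃ χ : EuclideanSpace ℝ (Fin 2) → ℝ,
    ContDiff ℝ 1 χ ∧ HasCompactSupport χ ∧ (∀ x, 0 ≤ χ x) ∧ (∀ x, χ x ≤ 1) ∧
    (∀ x, ‖x‖ ≤ n → χ x = 1) ∧ ∀ x, ‖fderiv ℝ χ x‖ ≤ K := by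
  let b : ContDiffBump (0 : EuclideanSpace ℝ (Fin 2)) := ⟨1, 2, by norm_num, by norm_num⟩
  have hb : ContDiff ℝ 1 b := b.contDiff
  have hbc : HasCompactSupport b := b.hasCompactSupport
  obtain ⟨K, hK⟩ := (hb.continuous_fderiv one_ne_zero).bounded_above_of_compact_support
    (hbc.fderiv (𝕜 := ℝ))
  have hK0 : 0 ≤ K := (norm_nonneg _).trans (hK 0)
  refine ⟨K, hK0, fun n => ?_⟩
  have hn : (0:ℝ) < n + 1 := by positivity
  set c : ℝ := ((n:ℝ) + 1)⁻¹ with hc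
  have hc0 : 0 < c := by positivity
  have hc1 : c ≤ 1 := inv_le_one_of_one_le₀ (by simp)
  refine ⟨fun x => b (c • x), hb.comp (contDiff_const_smul c), hbc.comp_smul hc0.ne',
    fun x => b.nonneg, fun x => b.le_one, fun x hx => ?_, fun x => ?_⟩
  · apply b.one_of_mem_closedBall
    simp only [b, mem_closedBall_zero_iff, norm_smul, Real.norm_eq_abs, abs_of_pos hc0]
    rw [hc, inv_mul_le_iff₀ hn]; linarith
  · rw [fderiv_comp_smul, norm_smul, Real.norm_eq_abs, abs_of_pos hc0]
    calc c * _ ≤ 1 * K := by gcongr; exact hK _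
      _ = K := one_mul K

set_option maxHeartbeats 1000000 in
lemma aux_tail (u : EuclideanSpace ℝ (Fin 2) → ℝ)
    (hu : ContDiff ℝ 1 u)
    (hu2 : Integrable (fun x => (u x) ^ 2))
    (hgrad : Integrable (fun x => ‖fderiv ℝ u x‖ ^ 2)) (ε : ℝ) (hε : 0 < ε) :
    ∃ T₀ : ℝ, 0 < T₀ ∧ ∀ T, T₀ ≤ T → ∃ V : ℝ, 0 ≤ V ∧ ∀ m : ℕ, 0 < m →
      volume {x | T + m ≤ u x} ≤ ENNReal.ofReal (ε ^ (m ^ 2) * V) := by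
  obtain ⟨A, hA, hstep⟩ := aux_step
  obtain ⟨K, hK, hcut⟩ := aux_cutoff
  set G : EuclideanSpace ℝ (Fin 2) → ℝ := fun x => 2 * ‖fderiv ℝ u x‖ ^ 2 + 2 * K ^ 2 * u x ^ 2
    with hG
  have hGi : Integrable G := (hgrad.const_mul 2).add (hu2.const_mul _)
  have hG0 : ∀ x, 0 ≤ G x := fun x => by simp only [hG]; positivity
  have hsm : ∀ T : ℝ, MeasurableSet {x | T ≤ |u x|} := fun T =>
    (isClosed_le continuous_const hu.continuous.abs).measurableSet
  have hlim : Filter.Tendsto (fun n : ℕ => ∫ x in {x | (n:ℝ) ≤ |u x|}, G x) Filter.atTop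
      (nhds 0) := by
    have := tendsto_setIntegral_of_antitone (μ := volume) (f := G)
      (s := fun n : ℕ => {x | (n:ℝ) ≤ |u x|}) (fun n => hsm n)
      (fun i j hij x hx => by
        simp only [Set.mem_ofPred_eq] at hx ⊢
        exact le_trans (by exact_mod_cast hij) hx) ⟨0, hGi.integrableOn⟩
    have he : (⋂ n : ℕ, {x | (n:ℝ) ≤ |u x|}) = ∅ := by
      ext x
      simp only [Set.mem_iInter, Set.mem_ofPred_eq, Set.mem_empty_iff_false, iff_false, not_forall,
        not_le]
      exact exists_nat_gt _
    rwa [he, Measure.restrict_empty, integral_zero_measure] at this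
  have hlim2 := hlim.const_mul A
  rw [mul_zero] at hlim2
  obtain ⟨N, hN, hN1⟩ := ((hlim2.eventually_lt_const hε).and (Filter.eventually_ge_atTop 1)).exists
  have hN1' : (1:ℝ) ≤ N := by exact_mod_cast hN1
  refine ⟨N, by linarith, fun T hT => ⟨volume.real {x | T ≤ |u x|}, measureReal_nonneg, ?_⟩⟩
  intro m hm
  have hT0 : 0 < T := by linarith
  have hVfin : volume {x | T ≤ |u x|} ≠ ⊤ := by
    have h1 := hu2.measure_norm_ge_lt_top (ε := T ^ 2) (by positivity)
    refine ((measure_mono ?_).trans_lt h1).ne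
    intro x hx
    simp only [Set.mem_ofPred_eq, norm_pow, Real.norm_eq_abs] at *
    gcongr
  have hAT : A * ∫ x in {x | T ≤ |u x|}, G x ≤ ε := by
    refine le_trans ?_ hN.le
    refine mul_le_mul_of_nonneg_left ?_ hA
    refine setIntegral_mono_set hGi.integrableOn (.of_forall hG0) (LE.le.eventuallyLE ?_)
    intro x hx
    exact hT.trans hx
  -- bound for each cutoff
  have hcutb : ∀ n : ℕ, volume {x | ‖x‖ ≤ n ∧ T + m ≤ u x} ≤
      ENNReal.ofReal (ε ^ (m ^ 2) * volume.real {x | T ≤ |u x|}) := by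
    intro n
    obtain ⟨χ, hχ, hχc, hχ0, hχ1, hχe, hχd⟩ := hcut n
    set v : EuclideanSpace ℝ (Fin 2) → ℝ := fun x => χ x * u x with hv
    have hvC : ContDiff ℝ 1 v := hχ.mul hu
    have hvc : HasCompactSupport v := hχc.mul_right
    have hvu : ∀ t, 0 < t → {x | t ≤ v x} ⊆ {x | t ≤ |u x|} := by
      intro t ht x hx
      simp only [Set.mem_ofPred_eq, hv] at *
      calc t ≤ |χ x * u x| := hx.trans (le_abs_self _)
        _ = χ x * |u x| := by rw [abs_mul, abs_of_nonneg (hχ0 x)]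
        _ ≤ 1 * |u x| := by gcongr; exact hχ1 x
        _ = _ := one_mul _
    have hvi : Integrable (fun x => ‖fderiv ℝ v x‖ ^ 2) := (aux_fd v hvC hvc).2
    have hvm : ∀ t : ℝ, MeasurableSet {x | t ≤ v x} := fun t =>
      (isClosed_le continuous_const hvC.continuous).measurableSet
    have hvd : ∀ x, ‖fderiv ℝ v x‖ ^ 2 ≤ G x := by
      intro x
      have e : fderiv ℝ v x = χ x • fderiv ℝ u x + u x • fderiv ℝ χ x :=
        fderiv_fun_mul (hχ.differentiable one_ne_zero x) (hu.differentiable one_ne_zero x)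
      have h1 : ‖fderiv ℝ v x‖ ≤ ‖fderiv ℝ u x‖ + |u x| * K := by
        rw [e]
        refine (norm_add_le _ _).trans ?_
        rw [norm_smul, norm_smul, Real.norm_eq_abs, Real.norm_eq_abs, abs_of_nonneg (hχ0 x)]
        gcongr
        · exact mul_le_of_le_one_left (norm_nonneg _) (hχ1 x)
        · exact hχd x
      have h2 := pow_le_pow_left₀ (norm_nonneg _) h1 2
      simp only [hG]
      nlinarith [sq_nonneg (‖fderiv ℝ u x‖ - |u x| * K), sq_abs (u x)]
    have hit := aux_iter (fun t => volume.real {x | t ≤ v x})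
      (fun t => ∫ x in {x | t ≤ v x}, ‖fderiv ℝ v x‖ ^ 2) A T hT0 hA (fun t => measureReal_nonneg)
      (fun t => integral_nonneg fun x => sq_nonneg _)
      (fun s t hst => setIntegral_mono_set hvi.integrableOn (.of_forall fun x => sq_nonneg _)
        (LE.le.eventuallyLE fun x hx => hst.trans hx))
      (fun t h ht hh => hstep v hvC hvc t h ht hh) m hm
    have hF : ∫ x in {x | T ≤ v x}, ‖fderiv ℝ v x‖ ^ 2 ≤ ∫ x in {x | T ≤ |u x|}, G x :=
      calc _ ≤ ∫ x in {x | T ≤ v x}, G x :=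
            setIntegral_mono hvi.integrableOn hGi.integrableOn hvd
        _ ≤ _ := setIntegral_mono_set hGi.integrableOn (.of_forall hG0)
            (LE.le.eventuallyLE (hvu T hT0))
    have hF0 : 0 ≤ ∫ x in {x | T ≤ v x}, ‖fderiv ℝ v x‖ ^ 2 := integral_nonneg fun x => sq_nonneg _
    have hfin : volume {x | T + m ≤ v x} ≠ ⊤ := by
      refine ((measure_mono ?_).trans_lt hVfin.lt_top).ne
      refine (hvu (T + m) (by positivity)).trans fun x hx => ?_
      simp only [Set.mem_ofPred_eq] at *
      have : (0:ℝ) ≤ m := by positivity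
      linarith
    calc volume {x | ‖x‖ ≤ n ∧ T + m ≤ u x} ≤ volume {x | T + m ≤ v x} := by
          refine measure_mono fun x hx => ?_
          simp only [Set.mem_ofPred_eq, hv] at *
          rw [hχe x hx.1, one_mul]; exact hx.2
      _ = ENNReal.ofReal (volume.real {x | T + m ≤ v x}) := (ofReal_measureReal hfin).symm
      _ ≤ _ := by
        apply ENNReal.ofReal_le_ofReal
        refine hit.trans ?_
        have hle : A * ∫ x in {x | T ≤ v x}, ‖fderiv ℝ v x‖ ^ 2 ≤ ε :=
          le_trans (mul_le_mul_of_nonneg_left hF hA) hAT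
        exact mul_le_mul (pow_le_pow_left₀ (mul_nonneg hA hF0) hle _)
          (measureReal_mono (hvu T hT0) hVfin) measureReal_nonneg (by positivity)
  have hun : {x | T + m ≤ u x} = ⋃ n : ℕ, {x | ‖x‖ ≤ n ∧ T + m ≤ u x} := by
    ext x
    simp only [Set.mem_iUnion, Set.mem_ofPred_eq]
    exact ⟨fun h => (exists_nat_ge ‖x‖).imp fun n hn => ⟨hn, h⟩, fun ⟨n, hn⟩ => hn.2⟩
  have hmono : Monotone (fun n : ℕ => {x | ‖x‖ ≤ n ∧ T + m ≤ u x}) := fun i j hij x hx =>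
    ⟨hx.1.trans (by exact_mod_cast hij), hx.2⟩
  rw [hun, hmono.measure_iUnion]
  exact iSup_le hcutb

theorem stmt_1 (α : ℝ) (hα : 0 < α) (u : EuclideanSpace ℝ (Fin 2) → ℝ)
    (hu : ContDiff ℝ 1 u)
    (hu2 : Integrable (fun x => (u x) ^ 2))
    (hgrad : Integrable (fun x => ‖fderiv ℝ u x‖ ^ 2)) :
    Integrable (fun x => Real.exp (α * (u x) ^ 2) - 1) := by
  set ε : ℝ := Real.exp (-(2 * α)) / 2 with hε
  obtain ⟨T₁, hT₁, h₁⟩ := aux_tail u hu hu2 hgrad ε (by positivity)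
  obtain ⟨T₂, hT₂, h₂⟩ := aux_tail (fun x => -u x) hu.neg (by simpa using hu2)
    (by simpa [fderiv_fun_neg] using hgrad) ε (by positivity)
  set T := max T₁ T₂ with hT
  obtain ⟨V₁, hV₁, h₁⟩ := h₁ T (le_max_left _ _)
  obtain ⟨V₂, hV₂, h₂⟩ := h₂ T (le_max_right _ _)
  have hT0 : 0 < T := hT₁.trans_le (le_max_left _ _)
  have hmeas : ∀ m : ℕ, 0 < m → volume {x | T + m ≤ |u x|} ≤
      ENNReal.ofReal (ε ^ (m ^ 2) * (V₁ + V₂)) := by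
    intro m hm
    rw [mul_add, ENNReal.ofReal_add (by positivity) (by positivity)]
    refine le_trans ?_ (add_le_add (h₁ m hm) (h₂ m hm))
    refine le_trans (measure_mono ?_) (measure_union_le _ _)
    intro x hx
    simp only [Set.mem_ofPred_eq, Set.mem_union] at hx ⊢
    exact le_abs.1 hx
  have hsm : ∀ T : ℝ, MeasurableSet {x | T ≤ |u x|} := fun T =>
    (isClosed_le continuous_const hu.continuous.abs).measurableSet
  have hcont : Continuous (fun x => Real.exp (α * (u x) ^ 2) - 1) := by
    have := hu.continuous
    fun_prop
  refine ⟨hcont.aestronglyMeasurable, ?_⟩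
  set B : ℝ := α * Real.exp (α * (T + 1) ^ 2) with hB
  set W : ℝ := Real.exp (2 * α * (T + 2) ^ 2) with hW
  set ind : ℕ → EuclideanSpace ℝ (Fin 2) → ENNReal := fun k =>
    Set.indicator {x | T + (k + 1 : ℕ) ≤ |u x|}
      (fun _ => ENNReal.ofReal (Real.exp (α * (T + k + 2) ^ 2))) with hind
  have hpt : ∀ x, ‖Real.exp (α * (u x) ^ 2) - 1‖ₑ ≤
      ENNReal.ofReal (B * u x ^ 2) + ∑' k, ind k x := by
    intro x
    have hnn : 0 ≤ Real.exp (α * (u x) ^ 2) - 1 := by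
      have := Real.add_one_le_exp (α * (u x) ^ 2)
      have : 0 ≤ α * (u x) ^ 2 := by positivity
      linarith
    rw [Real.enorm_eq_ofReal hnn]
    by_cases hx : |u x| < T + 1
    · refine le_add_right (ENNReal.ofReal_le_ofReal ?_)
      have hy : u x ^ 2 ≤ (T + 1) ^ 2 := by
        rw [← sq_abs]; gcongr
      have hy2 : Real.exp (α * (u x) ^ 2) ≤ Real.exp (α * (T + 1) ^ 2) := by gcongr
      have h3 := Real.add_one_le_exp (-(α * (u x) ^ 2))
      have h4 : Real.exp (α * (u x) ^ 2) * Real.exp (-(α * (u x) ^ 2)) = 1 := by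
        rw [← Real.exp_add]; simp
      have h5 := mul_le_mul_of_nonneg_left h3 (Real.exp_pos (α * (u x) ^ 2)).le
      rw [h4] at h5
      have h6 := mul_le_mul_of_nonneg_left hy2 (show 0 ≤ α * u x ^ 2 by positivity)
      simp only [hB]
      nlinarith
    · push Not at hx
      refine le_add_left ?_
      set k : ℕ := ⌊|u x| - (T + 1)⌋₊ with hk
      have hk1 : (k:ℝ) ≤ |u x| - (T + 1) := Nat.floor_le (by linarith)
      have hk2 : |u x| - (T + 1) < k + 1 := Nat.lt_floor_add_one _
      refine le_trans ?_ (ENNReal.le_tsum k)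
      simp only [hind]
      rw [Set.indicator_of_mem (by simp only [Set.mem_ofPred_eq]; push_cast; linarith)]
      apply ENNReal.ofReal_le_ofReal
      have : Real.exp (α * u x ^ 2) ≤ Real.exp (α * (T + k + 2) ^ 2) := by
        rw [← sq_abs (u x)]; gcongr; linarith
      linarith
  refine (lintegral_mono hpt).trans_lt ?_
  rw [lintegral_add_left (by have := hu.continuous; fun_prop), lintegral_tsum (fun k =>
    (measurable_const.indicator (hsm _)).aemeasurable)]
  refine ENNReal.add_lt_top.2 ⟨?_, ?_⟩
  · have := (hu2.const_mul B).lintegral_lt_top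
    exact this
  have hterm : ∀ k, ∫⁻ x, ind k x ≤ ENNReal.ofReal (W * (V₁ + V₂) * (1 / 2) ^ k) := by
    intro k
    simp only [hind]
    rw [lintegral_indicator_const (hsm _)]
    refine (mul_le_mul_right (hmeas (k + 1) (by positivity)) _).trans ?_
    rw [← ENNReal.ofReal_mul (by positivity)]
    apply ENNReal.ofReal_le_ofReal
    have e1 : ε ^ ((k + 1) ^ 2) = Real.exp (-(2 * α) * (k + 1) ^ 2) * (1 / 2) ^ ((k + 1) ^ 2) := by
      rw [hε, div_eq_mul_one_div, mul_pow, ← Real.exp_nat_mul]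
      push_cast; ring_nf
    have e2 : Real.exp (α * (T + k + 2) ^ 2) * Real.exp (-(2 * α) * (k + 1) ^ 2) ≤ W := by
      rw [← Real.exp_add]
      apply Real.exp_le_exp.2
      have : (T + k + 2) ^ 2 ≤ 2 * (k + 1) ^ 2 + 2 * (T + 2) ^ 2 := by
        have : (0:ℝ) ≤ k := by positivity
        nlinarith [sq_nonneg ((k:ℝ) + 1 - (T + 1))]
      nlinarith
    have e3 : (1 / 2 : ℝ) ^ ((k + 1) ^ 2) ≤ (1 / 2) ^ k :=
      pow_le_pow_of_le_one (by norm_num) (by norm_num) (by nlinarith)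
    rw [e1]
    calc _ = (Real.exp (α * (T + k + 2) ^ 2) * Real.exp (-(2 * α) * (k + 1) ^ 2)) * (V₁ + V₂)
          * (1 / 2) ^ ((k + 1) ^ 2) := by ring
      _ ≤ _ := by gcongr
  refine (ENNReal.tsum_le_tsum hterm).trans_lt ?_
  have hsum : Summable (fun k : ℕ => W * (V₁ + V₂) * (1 / 2 : ℝ) ^ k) :=
    (summable_geometric_two).mul_left _
  exact hsum.tsum_ofReal_lt_top
end

section
/- For every α with 0 < α < 4π and every M > 0 there exists a constant C₁ = C₁(M, α) > 0 such that for every continuously differentiable function u : ℝ² → ℝ with ∫_{ℝ²} |∇u|² dx ≤ 1 and ∫_{ℝ²} u² dx ≤ M², one has ∫_{ℝ²} ( e^{α u(x)²} − 1 ) dx ≤ C₁. -/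
open MeasureTheory Real ENNReal

abbrev E2 := EuclideanSpace ℝ (Fin 2)

lemma polar_lint (h : E2 → ℝ≥0∞) (hh : Measurable h) :
    ∫⁻ z, h z = ∫⁻ t in Set.Ioo (-π) π, ∫⁻ r in Set.Ioi (0:ℝ),
      ENNReal.ofReal r * h !₂[r * cos t, r * sin t] := by
  have m1 : Measurable (fun p : ℝ × ℝ => (!₂[p.1, p.2] : E2)) := by
    apply Continuous.measurable
    fun_prop
  have m2 : Measurable (fun p : ℝ × ℝ => (!₂[p.1 * cos p.2, p.1 * sin p.2] : E2)) := by
    apply Continuous.measurable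
    fun_prop
  have e1 : MeasurePreserving (fun p : ℝ × ℝ => (!₂[p.1, p.2] : E2)) := by
    have := (EuclideanSpace.volume_preserving_symm_measurableEquiv_toLp (Fin 2)).symm.comp
      (volume_preserving_finTwoArrow ℝ).symm
    exact this
  rw [← e1.lintegral_comp hh, ← lintegral_comp_polarCoord_symm]
  rw [polarCoord_target, Measure.volume_eq_prod, ← Measure.prod_restrict, lintegral_prod_symm]
  · simp [polarCoord_symm_apply]
  · simp only [polarCoord_symm_apply, smul_eq_mul]
    exact ((ENNReal.measurable_ofReal.comp measurable_fst).mul (hh.comp m2)).aemeasurable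

lemma radial_lint (k : ℝ → ℝ≥0∞) (hk : Measurable k) :
    ∫⁻ z : E2, k ‖z‖ = ENNReal.ofReal (2*π) * ∫⁻ r in Set.Ioi (0:ℝ), ENNReal.ofReal r * k r := by
  rw [polar_lint (fun z => k ‖z‖) (hk.comp measurable_norm)]
  have : ∀ t : ℝ, ∫⁻ r in Set.Ioi (0:ℝ), ENNReal.ofReal r * k ‖(!₂[r * cos t, r * sin t] : E2)‖
      = ∫⁻ r in Set.Ioi (0:ℝ), ENNReal.ofReal r * k r := by
    intro t
    refine setLIntegral_congr_fun measurableSet_Ioi ?_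
    intro r hr
    have hr : 0 < r := hr
    have : ‖(!₂[r * cos t, r * sin t] : E2)‖ = r := by
      rw [EuclideanSpace.norm_eq]
      simp only [Fin.sum_univ_two, Matrix.cons_val_zero, Matrix.cons_val_one, norm_eq_abs, sq_abs]
      rw [show (r * cos t)^2 + (r * sin t)^2 = r^2 by
        have := sin_sq_add_cos_sq t
        linear_combination r^2 * this]
      exact Real.sqrt_sq hr.le
    simp only [this]
  simp only [this]
  rw [setLIntegral_const, mul_comm]
  congr 1
  rw [Real.volume_Ioo]; congr 1; ring

/-- FTC along a ray -/
lemma ray_bound (u : E2 → ℝ) (hu : ContDiff ℝ 1 u) (R : ℝ) (hR : 0 < R) (x e : E2) (he : ‖e‖ ≤ 1) :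
    ENNReal.ofReal |u x| ≤ ∫⁻ r in Set.Ioc 0 R,
      ENNReal.ofReal (‖fderiv ℝ u (x + r • e)‖ + |u (x + r • e)| / R) := by
  have hd : ∀ r : ℝ, HasDerivAt (fun r : ℝ => (1 - r/R) * u (x + r • e))
      ((-(1/R)) * u (x + r • e) + (1 - r/R) * (fderiv ℝ u (x + r • e) e)) r := by
    intro r
    have h1 : HasDerivAt (fun r : ℝ => 1 - r/R) (-(1/R)) r := by
      simpa using ((hasDerivAt_id r).div_const R).const_sub 1
    have h2 : HasDerivAt (fun r : ℝ => x + r • e) e r := by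
      simpa using ((hasDerivAt_id r).smul_const e).const_add x
    have h3 := ((hu.differentiable (by norm_num)) (x + r • e)).hasFDerivAt.comp_hasDerivAt r h2
    exact h1.mul h3
  have hc : Continuous (fun r : ℝ => (-(1/R)) * u (x + r • e) + (1 - r/R) * (fderiv ℝ u (x + r • e) e)) := by
    have c1 := hu.continuous
    have c2 := hu.continuous_fderiv (by norm_num)
    fun_prop
  have := intervalIntegral.integral_eq_sub_of_hasDerivAt (a := 0) (b := R) (fun r _ => hd r)
    (hc.intervalIntegrable _ _)
  rw [div_self hR.ne'] at this
  simp only [sub_self, zero_mul, zero_div, sub_zero, zero_smul, add_zero, one_mul, zero_sub] at this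
  rw [intervalIntegral.integral_of_le hR.le] at this
  rw [← Real.enorm_eq_ofReal_abs, ← enorm_neg, ← this]
  refine (enorm_integral_le_lintegral_enorm _).trans ?_
  refine setLIntegral_mono' measurableSet_Ioc ?_
  intro r hr
  rw [Real.enorm_eq_ofReal_abs]
  apply ENNReal.ofReal_le_ofReal
  have h1 : |fderiv ℝ u (x + r • e) e| ≤ ‖fderiv ℝ u (x + r • e)‖ := by
    have := (fderiv ℝ u (x + r • e)).le_opNorm e
    rw [Real.norm_eq_abs] at this
    nlinarith [norm_nonneg (fderiv ℝ u (x + r • e)), norm_nonneg e]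
  have h2 : |1 - r/R| ≤ 1 := by
    have : r / R ≤ 1 := (div_le_one hR).2 hr.2
    have : 0 ≤ r / R := div_nonneg hr.1.le hR.le
    rw [abs_le]; constructor <;> linarith
  calc _ ≤ |(-(1/R)) * u (x + r • e)| + |(1 - r/R) * (fderiv ℝ u (x + r • e) e)| := abs_add_le _ _
    _ = |u (x + r • e)| / R + |1 - r/R| * |fderiv ℝ u (x + r • e) e| := by
      rw [abs_mul, abs_mul, abs_neg, abs_of_pos (by positivity : 0 < 1/R)]; ring
    _ ≤ _ := by nlinarith [abs_nonneg (1 - r/R), abs_nonneg (fderiv ℝ u (x + r • e) e)]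

noncomputable def kb (R b r : ℝ) : ℝ := (Set.Ioc 0 R).indicator (fun r => r ^ (-b)) r

lemma kb_meas (R b : ℝ) : Measurable (kb R b) := by
  unfold kb
  exact (measurable_id.pow_const _).indicator measurableSet_Ioc

lemma kb_nonneg (R b r : ℝ) : 0 ≤ kb R b r := by
  unfold kb
  refine Set.indicator_nonneg (fun r hr => ?_) r
  exact Real.rpow_nonneg hr.1.le _

lemma kb_fin (R b : ℝ) (hR : 0 < R) (hb : b < 2) :
    ∫⁻ z : E2, ENNReal.ofReal (kb R b ‖z‖) ≠ ⊤ := by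
  rw [radial_lint (fun r => ENNReal.ofReal (kb R b r)) (kb_meas R b).ennreal_ofReal]
  apply ENNReal.mul_ne_top ENNReal.ofReal_ne_top
  have h1 : IntegrableOn (fun r : ℝ => r ^ (1 - b)) (Set.Ioc 0 R) := by
    have := intervalIntegral.intervalIntegrable_rpow' (a := 0) (b := R) (r := 1 - b) (by linarith)
    exact (intervalIntegrable_iff_integrableOn_Ioc_of_le hR.le).1 this
  have h2 : ∫⁻ r in Set.Ioi (0:ℝ), ENNReal.ofReal r * ENNReal.ofReal (kb R b r)
      ≤ ∫⁻ r in Set.Ioc (0:ℝ) R, ENNReal.ofReal (r ^ (1-b)) := by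
    rw [← lintegral_indicator measurableSet_Ioi, ← lintegral_indicator measurableSet_Ioc]
    apply lintegral_mono
    intro r
    by_cases hr : r ∈ Set.Ioc 0 R
    · have h0 : 0 < r := hr.1
      simp only [kb, Set.indicator_of_mem hr, Set.indicator_of_mem (show r ∈ Set.Ioi (0:ℝ) from h0)]
      rw [← ENNReal.ofReal_mul h0.le, sub_eq_add_neg, Real.rpow_add h0, Real.rpow_one]
    · have h0 : kb R b r = 0 := Set.indicator_of_notMem hr _
      refine le_trans (Set.indicator_le_self _ _ _) ?_
      simp [h0]
  refine ne_top_of_le_ne_top ?_ h2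
  rw [← ofReal_integral_eq_lintegral_ofReal h1]
  · exact ENNReal.ofReal_ne_top
  · filter_upwards [ae_restrict_mem measurableSet_Ioc] with r hr
    exact Real.rpow_nonneg hr.1.le _

noncomputable def gk (R b l r : ℝ) : ℝ :=
  (Set.Ioc 0 R).indicator (fun r => r⁻¹ / Real.sqrt (1 + l * r ^ (-b))) r

lemma gk_meas (R b l : ℝ) : Measurable (gk R b l) := by
  unfold gk
  refine Measurable.indicator ?_ measurableSet_Ioc
  fun_prop

lemma gk_int (R b l : ℝ) (hR : 0 < R) (hb : 1 < b) (hl : 0 < l) :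
    ∫⁻ z : E2, ENNReal.ofReal (gk R b l ‖z‖ ^ 2) ≤
      ENNReal.ofReal (2 * π * (1 / b * Real.log (1 + R ^ b / l))) := by
  rw [radial_lint (fun r => ENNReal.ofReal (gk R b l r ^ 2)) ((gk_meas R b l).pow_const 2).ennreal_ofReal,
    ENNReal.ofReal_mul (p := 2 * π) (by positivity)]
  refine mul_le_mul_right ?_ _
  have h2 : ∫⁻ r in Set.Ioi (0:ℝ), ENNReal.ofReal r * ENNReal.ofReal (gk R b l r ^ 2)
      ≤ ∫⁻ r in Set.Ioc (0:ℝ) R, ENNReal.ofReal (r ^ (b-1) / (l + r ^ b)) := by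
    rw [← lintegral_indicator measurableSet_Ioi, ← lintegral_indicator measurableSet_Ioc]
    apply lintegral_mono
    intro r
    by_cases hr : r ∈ Set.Ioc 0 R
    · have h0 : 0 < r := hr.1
      simp only [gk, Set.indicator_of_mem hr, Set.indicator_of_mem (show r ∈ Set.Ioi (0:ℝ) from h0)]
      rw [← ENNReal.ofReal_mul h0.le]
      apply le_of_eq
      congr 1
      have hp : 0 < r ^ b := Real.rpow_pos_of_pos h0 b
      rw [Real.rpow_neg h0.le, Real.rpow_sub h0, Real.rpow_one, div_pow, Real.sq_sqrt (by positivity)]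
      field_simp
      ring
    · have h0 : gk R b l r = 0 := Set.indicator_of_notMem hr _
      refine le_trans (Set.indicator_le_self _ _ _) ?_
      simp [h0]
  refine h2.trans ?_
  have hpos : ∀ r : ℝ, 0 ≤ r → 0 < l + r ^ b := fun r hr => by
    have := Real.rpow_nonneg hr b
    linarith
  have hc : ContinuousOn (fun r : ℝ => r ^ (b-1) / (l + r ^ b)) (Set.uIcc 0 R) := by
    rw [Set.uIcc_of_le hR.le]
    apply ContinuousOn.div
    · exact (Real.continuous_rpow_const (by linarith)).continuousOn
    · exact (continuous_const.add (Real.continuous_rpow_const (by linarith))).continuousOn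
    · intro r hr
      exact (hpos r hr.1).ne'
  have hint := hc.intervalIntegrable (μ := volume)
  have hd : ∀ r ∈ Set.uIcc 0 R, HasDerivAt (fun r : ℝ => 1 / b * Real.log (1 + r ^ b / l))
      (r ^ (b-1) / (l + r ^ b)) r := by
    intro r hr
    rw [Set.uIcc_of_le hR.le] at hr
    have hp := hpos r hr.1
    have h3 : 1 + r ^ b / l ≠ 0 := by
      rw [show 1 + r ^ b / l = (l + r ^ b) / l by field_simp]
      positivity
    have := (((((Real.hasDerivAt_rpow_const (x := r) (p := b) (Or.inr hb.le)).div_const l).const_add 1).log h3).const_mul (1/b))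
    refine this.congr_deriv ?_
    have hb0 : b ≠ 0 := by linarith
    have hp' := hp.ne'
    rw [show 1 + r ^ b / l = (l + r ^ b) / l by field_simp]
    generalize r ^ (b - 1) = p
    generalize l + r ^ b = q at *
    field_simp
  have := intervalIntegral.integral_eq_sub_of_hasDerivAt hd hint
  rw [Real.zero_rpow (by linarith), zero_div, add_zero, Real.log_one, mul_zero, sub_zero,
    intervalIntegral.integral_of_le hR.le] at this
  rw [← this, ofReal_integral_eq_lintegral_ofReal]
  · exact (intervalIntegrable_iff_integrableOn_Ioc_of_le hR.le).1 hint
  · filter_upwards [ae_restrict_mem measurableSet_Ioc] with r hr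
    exact div_nonneg (Real.rpow_nonneg hr.1.le _) (hpos r hr.1.le).le

lemma pot_bound (u : E2 → ℝ) (hu : ContDiff ℝ 1 u) (R b l : ℝ) (hR : 0 < R) (hl : 0 < l) (x : E2) :
    ENNReal.ofReal (2 * π) * ENNReal.ofReal |u x| ≤ ∫⁻ z : E2,
      ENNReal.ofReal ((‖fderiv ℝ u (x + z)‖ + |u (x + z)| / R) * Real.sqrt (1 + l * kb R b ‖z‖)) *
        ENNReal.ofReal (gk R b l ‖z‖) := by
  have c1 := hu.continuous
  have c2 := hu.continuous_fderiv (by norm_num)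
  have hm : Measurable (fun z : E2 =>
      ENNReal.ofReal ((‖fderiv ℝ u (x + z)‖ + |u (x + z)| / R) * Real.sqrt (1 + l * kb R b ‖z‖)) *
        ENNReal.ofReal (gk R b l ‖z‖)) := by
    have m1 : Measurable (fun z : E2 => ‖fderiv ℝ u (x + z)‖ + |u (x + z)| / R) := by
      apply Continuous.measurable
      fun_prop
    have m2 : Measurable (fun z : E2 => kb R b ‖z‖) := (kb_meas R b).comp measurable_norm
    have m3 : Measurable (fun z : E2 => gk R b l ‖z‖) := (gk_meas R b l).comp measurable_norm
    exact (m1.mul ((m2.const_mul l).const_add 1).sqrt).ennreal_ofReal.mul m3.ennreal_ofReal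
  rw [polar_lint _ hm]
  have key : ∀ t : ℝ, ENNReal.ofReal |u x| ≤ ∫⁻ r in Set.Ioi (0:ℝ), ENNReal.ofReal r *
      (ENNReal.ofReal ((‖fderiv ℝ u (x + !₂[r * cos t, r * sin t])‖ + |u (x + !₂[r * cos t, r * sin t])| / R) * Real.sqrt (1 + l * kb R b ‖(!₂[r * cos t, r * sin t] : E2)‖)) *
        ENNReal.ofReal (gk R b l ‖(!₂[r * cos t, r * sin t] : E2)‖)) := by
    intro t
    have ne : ‖(!₂[cos t, sin t] : E2)‖ = 1 := by
      rw [EuclideanSpace.norm_eq]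
      simp
    have hs : ∀ r : ℝ, (!₂[r * cos t, r * sin t] : E2) = r • !₂[cos t, sin t] := by
      intro r
      ext i
      fin_cases i <;> simp
    refine (ray_bound u hu R hR x !₂[cos t, sin t] ne.le).trans ?_
    rw [← lintegral_indicator measurableSet_Ioi, ← lintegral_indicator measurableSet_Ioc]
    apply lintegral_mono
    intro r
    by_cases hr : r ∈ Set.Ioc 0 R
    · have h0 : 0 < r := hr.1
      have hn : ‖r • (!₂[cos t, sin t] : E2)‖ = r := by
        rw [norm_smul, ne, mul_one, Real.norm_eq_abs, abs_of_pos h0]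
      simp only [Set.indicator_of_mem hr, Set.indicator_of_mem (show r ∈ Set.Ioi (0:ℝ) from h0), hs, hn]
      rw [← ENNReal.ofReal_mul (by positivity), ← ENNReal.ofReal_mul h0.le]
      apply le_of_eq
      congr 1
      simp only [gk, kb, Set.indicator_of_mem hr]
      have : 0 < Real.sqrt (1 + l * r ^ (-b)) := by
        have := Real.rpow_pos_of_pos h0 (-b)
        positivity
      field_simp
    · simp only [Set.indicator_of_notMem hr]
      exact zero_le
  calc ENNReal.ofReal (2 * π) * ENNReal.ofReal |u x| = ∫⁻ t in Set.Ioo (-π) π, ENNReal.ofReal |u x| := by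
        rw [setLIntegral_const, mul_comm, Real.volume_Ioo]
        congr 2; ring
    _ ≤ _ := lintegral_mono (fun t => key t)

lemma cs (f g : E2 → ℝ) (hf : Measurable f) (hg : Measurable g) (hf0 : ∀ x, 0 ≤ f x) (hg0 : ∀ x, 0 ≤ g x)
   (a A B : ℝ) (ha : 0 ≤ a) (hA : 0 ≤ A) (hB : 0 ≤ B)
   (h : ENNReal.ofReal a ≤ ∫⁻ z, ENNReal.ofReal (f z) * ENNReal.ofReal (g z))
   (h1 : ∫⁻ z, ENNReal.ofReal (f z ^ 2) ≤ ENNReal.ofReal A)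
   (h2 : ∫⁻ z, ENNReal.ofReal (g z ^ 2) ≤ ENNReal.ofReal B) : a ^ 2 ≤ A * B := by
  have := ENNReal.lintegral_mul_le_Lp_mul_Lq volume Real.HolderConjugate.two_two
    hf.ennreal_ofReal.aemeasurable hg.ennreal_ofReal.aemeasurable
  have e : ∀ y : ℝ, 0 ≤ y → ENNReal.ofReal y ^ (2:ℝ) = ENNReal.ofReal (y ^ 2) := by
    intro y hy
    rw [ENNReal.rpow_two, ENNReal.ofReal_pow hy]
  simp only [e _ (hf0 _), e _ (hg0 _), Pi.mul_apply] at this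
  have h3 : ENNReal.ofReal a ≤ ENNReal.ofReal A ^ (1/2:ℝ) * ENNReal.ofReal B ^ (1/2:ℝ) :=
    (h.trans this).trans (by gcongr)
  rw [ENNReal.ofReal_rpow_of_nonneg hA (by norm_num), ENNReal.ofReal_rpow_of_nonneg hB (by norm_num),
    ← ENNReal.ofReal_mul (by positivity), ENNReal.ofReal_le_ofReal_iff (by positivity),
    ← Real.sqrt_eq_rpow, ← Real.sqrt_eq_rpow] at h3
  calc a ^ 2 ≤ (√A * √B) ^ 2 := by gcongr
    _ = A * B := by rw [mul_pow, Real.sq_sqrt hA, Real.sq_sqrt hB]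

lemma pointwise (u : E2 → ℝ) (hu : ContDiff ℝ 1 u) (α R b ε g : ℝ) (hα : 0 < α) (hR : 0 < R) (hb : 1 < b)
    (hε : 0 < ε) (hg : 0 < g) (hab : α * (1 + 3 * ε) ≤ 2 * π * b) (x : E2)
    (hT : ∫⁻ z, ENNReal.ofReal ((‖fderiv ℝ u z‖ + |u z| / R) ^ 2) ≤ ENNReal.ofReal (1 + 2 * ε))
    (hG : ∫⁻ z, ENNReal.ofReal ((‖fderiv ℝ u (x + z)‖ + |u (x + z)| / R) ^ 2) * ENNReal.ofReal (kb R b ‖z‖)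
      ≤ ENNReal.ofReal g) :
    Real.exp (α * u x ^ 2) - 1 ≤ R ^ b / ε * g := by
  have c1 := hu.continuous
  have c2 := hu.continuous_fderiv (by norm_num)
  have m1 : Measurable (fun z : E2 => ‖fderiv ℝ u (x + z)‖ + |u (x + z)| / R) := by
    apply Continuous.measurable
    fun_prop
  have m2 : Measurable (fun z : E2 => kb R b ‖z‖) := (kb_meas R b).comp measurable_norm
  have m3 : Measurable (fun z : E2 => gk R b (ε / g) ‖z‖) := (gk_meas R b _).comp measurable_norm
  have hl : 0 < ε / g := by positivity
  have hX : 0 < R ^ b / (ε / g) := div_pos (Real.rpow_pos_of_pos hR b) hl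
  have hlog : 0 ≤ Real.log (1 + R ^ b / (ε / g)) := Real.log_nonneg (by linarith)
  have hk := fun z : E2 => kb_nonneg R b ‖z‖
  have hgk : ∀ z : E2, 0 ≤ gk R b (ε / g) ‖z‖ := by
    intro z
    unfold gk
    refine Set.indicator_nonneg (fun r hr => ?_) _
    have := hr.1
    positivity
  have h1 := cs (fun z => (‖fderiv ℝ u (x + z)‖ + |u (x + z)| / R) * Real.sqrt (1 + ε / g * kb R b ‖z‖))
    (fun z => gk R b (ε / g) ‖z‖) (m1.mul ((m2.const_mul _).const_add 1).sqrt) m3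
    (fun z => by positivity) hgk (2 * π * |u x|) (1 + 3 * ε) (2 * π * (1 / b * Real.log (1 + R ^ b / (ε / g))))
    (by positivity) (by positivity) (by positivity)
    (by
      rw [ENNReal.ofReal_mul (by positivity)]
      exact pot_bound u hu R b (ε / g) hR hl x)
    (by
      have e : ∀ z : E2, ENNReal.ofReal (((‖fderiv ℝ u (x + z)‖ + |u (x + z)| / R) * Real.sqrt (1 + ε / g * kb R b ‖z‖)) ^ 2)
        = ENNReal.ofReal ((‖fderiv ℝ u (x + z)‖ + |u (x + z)| / R) ^ 2) + ENNReal.ofReal (ε / g) *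
          (ENNReal.ofReal ((‖fderiv ℝ u (x + z)‖ + |u (x + z)| / R) ^ 2) * ENNReal.ofReal (kb R b ‖z‖)) := by
        intro z
        have := hk z
        rw [← ENNReal.ofReal_mul (by positivity), ← ENNReal.ofReal_mul (by positivity),
          ← ENNReal.ofReal_add (by positivity) (by positivity), mul_pow, Real.sq_sqrt (by positivity)]
        congr 1; ring
      simp only [e]
      rw [lintegral_add_left (m1.pow_const 2).ennreal_ofReal, lintegral_const_mul' _ _ ENNReal.ofReal_ne_top,
        lintegral_add_left_eq_self (μ := volume) (fun z => ENNReal.ofReal ((‖fderiv ℝ u z‖ + |u z| / R) ^ 2)) x]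
      calc _ ≤ ENNReal.ofReal (1 + 2 * ε) + ENNReal.ofReal (ε / g) * ENNReal.ofReal g := by gcongr
        _ = _ := by
          rw [← ENNReal.ofReal_mul (by positivity), ← ENNReal.ofReal_add (by positivity) (by positivity)]
          congr 1
          field_simp
          ring)
    (gk_int R b (ε / g) hR hb hl)
  set L := Real.log (1 + R ^ b / (ε / g)) with hL
  have h2 : α * u x ^ 2 ≤ L := by
    rw [mul_pow, sq_abs] at h1
    have hπ := Real.pi_pos
    have hb0 : 0 < b := by linarith
    have h3 : 2 * π * b * u x ^ 2 ≤ (1 + 3 * ε) * L := by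
      have e2 : (1 + 3 * ε) * (2 * π * (1 / b * L)) = (2 * π / b) * ((1 + 3 * ε) * L) := by ring
      have e1 : (2 * π) ^ 2 * u x ^ 2 = (2 * π / b) * (2 * π * b * u x ^ 2) := by field_simp
      rw [e1, e2] at h1
      exact le_of_mul_le_mul_left h1 (by positivity)
    have h4 : α * (1 + 3 * ε) * u x ^ 2 ≤ 2 * π * b * u x ^ 2 := by gcongr
    have h5 : (1 + 3 * ε) * (α * u x ^ 2) ≤ (1 + 3 * ε) * L := by linarith
    exact le_of_mul_le_mul_left h5 (by positivity)
  have h3 : Real.exp (α * u x ^ 2) ≤ 1 + R ^ b / (ε / g) := by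
    rw [← Real.exp_log (show 0 < 1 + R ^ b / (ε / g) by linarith)]
    exact Real.exp_le_exp.2 h2
  have : R ^ b / (ε / g) = R ^ b / ε * g := by field_simp
  linarith

/-- Trudinger–Moser type uniform bound: for `0 < α < 4π` and `M > 0` there is
`C₁ > 0` such that every `C¹` function `u : ℝ² → ℝ` with `∫ |∇u|² ≤ 1` and
`∫ u² ≤ M²` satisfies `∫ (e^{α u²} - 1) ≤ C₁`. -/
theorem stmt_2 (α M : ℝ) (hα0 : 0 < α) (hα : α < 4 * Real.pi) (hM : 0 < M) :
    ∃ C₁ : ℝ, 0 < C₁ ∧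
      ∀ u : EuclideanSpace ℝ (Fin 2) → ℝ, ContDiff ℝ 1 u →
        (∫⁻ x, ENNReal.ofReal (‖fderiv ℝ u x‖ ^ 2)) ≤ 1 →
        (∫⁻ x, ENNReal.ofReal ((u x) ^ 2)) ≤ ENNReal.ofReal (M ^ 2) →
        (∫⁻ x, ENNReal.ofReal (Real.exp (α * (u x) ^ 2) - 1)) ≤
          ENNReal.ofReal C₁ := by
  have hπ := Real.pi_pos
  obtain ⟨b, hbdef⟩ : ∃ b, b = (α + 4 * π) / (4 * π) := ⟨_, rfl⟩
  obtain ⟨ε, hεdef⟩ : ∃ ε, ε = (4 * π - α) / (6 * α) := ⟨_, rfl⟩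
  have hb1 : 1 < b := by rw [hbdef, lt_div_iff₀ (by positivity)]; linarith
  have hb2 : b < 2 := by rw [hbdef, div_lt_iff₀ (by positivity)]; linarith
  have hε : 0 < ε := by rw [hεdef]; apply div_pos <;> linarith
  have hab : α * (1 + 3 * ε) ≤ 2 * π * b := by
    rw [hbdef, hεdef]
    apply le_of_eq
    field_simp
    ring
  obtain ⟨R, hRdef⟩ : ∃ R, R = M * (1 + 1 / ε) := ⟨_, rfl⟩
  have hR : 0 < R := by rw [hRdef]; positivity
  have hRb : 0 < R ^ b := Real.rpow_pos_of_pos hR b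
  have hK := kb_fin R b hR hb2
  set K := ∫⁻ z : E2, ENNReal.ofReal (kb R b ‖z‖) with hKdef
  refine ⟨R ^ b / ε * ((1 + 2 * ε) * K.toReal) + 1, by positivity, ?_⟩
  intro u hu hgrad hL2
  have c1 := hu.continuous
  have c2 := hu.continuous_fderiv (by norm_num)
  have hT : ∫⁻ z, ENNReal.ofReal ((‖fderiv ℝ u z‖ + |u z| / R) ^ 2) ≤ ENNReal.ofReal (1 + 2 * ε) := by
    have e : ∀ z, ENNReal.ofReal ((‖fderiv ℝ u z‖ + |u z| / R) ^ 2) ≤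
        ENNReal.ofReal (1 + ε) * ENNReal.ofReal (‖fderiv ℝ u z‖ ^ 2) +
        ENNReal.ofReal ((1 + 1 / ε) / R ^ 2) * ENNReal.ofReal (u z ^ 2) := by
      intro z
      rw [← ENNReal.ofReal_mul (by positivity), ← ENNReal.ofReal_mul (by positivity),
        ← ENNReal.ofReal_add (by positivity) (by positivity)]
      apply ENNReal.ofReal_le_ofReal
      have e1 : (1 + 1 / ε) / R ^ 2 * u z ^ 2 = (1 + 1 / ε) * (|u z| / R) ^ 2 := by
        rw [div_pow, sq_abs]; ring
      rw [e1]
      generalize |u z| / R = q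
      generalize ‖fderiv ℝ u z‖ = p
      have : (1 + ε) * p ^ 2 + (1 + 1 / ε) * q ^ 2 - (p + q) ^ 2 = (ε * p - q) ^ 2 / ε := by
        field_simp
        ring
      have : 0 ≤ (ε * p - q) ^ 2 / ε := by positivity
      linarith
    refine (lintegral_mono e).trans ?_
    rw [lintegral_add_left, lintegral_const_mul' _ _ ENNReal.ofReal_ne_top,
      lintegral_const_mul' _ _ ENNReal.ofReal_ne_top]
    · calc _ ≤ ENNReal.ofReal (1 + ε) * 1 + ENNReal.ofReal ((1 + 1 / ε) / R ^ 2) * ENNReal.ofReal (M ^ 2) := by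
            gcongr
        _ = ENNReal.ofReal (1 + ε + (1 + 1 / ε) / R ^ 2 * M ^ 2) := by
            rw [mul_one, ← ENNReal.ofReal_mul (by positivity), ← ENNReal.ofReal_add (by positivity) (by positivity)]
        _ ≤ _ := by
            apply ENNReal.ofReal_le_ofReal
            have : (1 + 1 / ε) / R ^ 2 * M ^ 2 = ε / (1 + ε) := by
              rw [hRdef]; field_simp; ring
            have : ε / (1 + ε) ≤ ε := div_le_self hε.le (by linarith)
            linarith
    · exact (c2.norm.pow 2).measurable.ennreal_ofReal.const_mul _
  have hpt : ∀ x, ENNReal.ofReal (Real.exp (α * (u x) ^ 2) - 1) ≤ ENNReal.ofReal (R ^ b / ε) *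
      ∫⁻ z, ENNReal.ofReal ((‖fderiv ℝ u (x + z)‖ + |u (x + z)| / R) ^ 2) * ENNReal.ofReal (kb R b ‖z‖) := by
    intro x
    set G := ∫⁻ z, ENNReal.ofReal ((‖fderiv ℝ u (x + z)‖ + |u (x + z)| / R) ^ 2) * ENNReal.ofReal (kb R b ‖z‖) with hG
    have hc : 0 < R ^ b / ε := by positivity
    by_cases hGt : G = ⊤
    · rw [hGt, ENNReal.mul_top (by simpa using hc)]
      exact le_top
    rw [← ENNReal.ofReal_toReal hGt, ← ENNReal.ofReal_mul hc.le]
    apply ENNReal.ofReal_le_ofReal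
    apply _root_.le_of_forall_pos_le_add
    intro δ hδ
    have hgpos : 0 < G.toReal + δ / (R ^ b / ε) := by positivity
    have := pointwise u hu α R b ε _ hα0 hR hb1 hε hgpos hab x hT (by
      rw [← hG, ← ENNReal.ofReal_toReal hGt]
      apply ENNReal.ofReal_le_ofReal
      rw [ENNReal.toReal_ofReal ENNReal.toReal_nonneg]
      have : 0 < δ / (R ^ b / ε) := by positivity
      linarith)
    rw [mul_add, mul_div_cancel₀ _ hc.ne'] at this
    exact this
  refine (lintegral_mono hpt).trans ?_
  rw [lintegral_const_mul' _ _ ENNReal.ofReal_ne_top, lintegral_lintegral_swap]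
  · have e : ∀ z : E2, ∫⁻ x, ENNReal.ofReal ((‖fderiv ℝ u (x + z)‖ + |u (x + z)| / R) ^ 2) * ENNReal.ofReal (kb R b ‖z‖)
        = (∫⁻ x, ENNReal.ofReal ((‖fderiv ℝ u x‖ + |u x| / R) ^ 2)) * ENNReal.ofReal (kb R b ‖z‖) := by
      intro z
      rw [lintegral_mul_const' _ _ ENNReal.ofReal_ne_top,
        lintegral_add_right_eq_self (μ := volume) (fun x => ENNReal.ofReal ((‖fderiv ℝ u x‖ + |u x| / R) ^ 2)) z]
    simp only [e]
    have mk : Measurable (fun z : E2 => ENNReal.ofReal (kb R b ‖z‖)) :=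
      ((kb_meas R b).comp measurable_norm).ennreal_ofReal
    rw [lintegral_const_mul _ mk]
    calc _ ≤ ENNReal.ofReal (R ^ b / ε) * (ENNReal.ofReal (1 + 2 * ε) * ENNReal.ofReal K.toReal) := by
          rw [ENNReal.ofReal_toReal hK]
          gcongr
      _ = ENNReal.ofReal (R ^ b / ε * ((1 + 2 * ε) * K.toReal)) := by
          rw [← ENNReal.ofReal_mul (by positivity), ← ENNReal.ofReal_mul (by positivity)]
      _ ≤ _ := ENNReal.ofReal_le_ofReal (by linarith)
  · have m1 : Measurable (fun p : E2 × E2 => (‖fderiv ℝ u (p.1 + p.2)‖ + |u (p.1 + p.2)| / R) ^ 2) := by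
      apply Continuous.measurable
      fun_prop
    have m2 : Measurable (fun p : E2 × E2 => kb R b ‖p.2‖) :=
      (kb_meas R b).comp (measurable_norm.comp measurable_snd)
    exact (m1.ennreal_ofReal.mul m2.ennreal_ofReal).aemeasurable
end

section
/- Let 0 < μ < 2 and let φ, ψ : ℝ² → [0, ∞) be measurable. Then ∫_{ℝ²} ∫_{ℝ²} φ(x) ψ(y) / |x − y|^μ dx dy ≤ ( ∫_{ℝ²} ∫_{ℝ²} φ(x) φ(y) / |x − y|^μ dx dy )^{1/2} · ( ∫_{ℝ²} ∫_{ℝ²} ψ(x) ψ(y) / |x − y|^μ dx dy )^{1/2}, where all integrals are taken in the extended nonnegative reals. -/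
open MeasureTheory Real ENNReal

lemma aux_fubini {X P : Type*} [MeasurableSpace X] [MeasurableSpace P] (m : Measure X) [SFinite m]
    (ν : Measure P) [SFinite ν] (h : X → P → ℝ≥0∞) (hh : Measurable (Function.uncurry h))
    (f g : X → ℝ≥0∞) (hf : Measurable f) (hg : Measurable g) :
    ∫⁻ x, ∫⁻ y, f x * g y * ∫⁻ p, h x p * h y p ∂ν ∂m ∂m =
      ∫⁻ p, (∫⁻ x, f x * h x p ∂m) * (∫⁻ y, g y * h y p ∂m) ∂ν := by
  have hhx : ∀ x, Measurable (h x) := fun x => hh.of_uncurry_left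
  have hhp : ∀ p, Measurable (fun x => h x p) := fun p => hh.of_uncurry_right
  have hF : Measurable (Function.uncurry fun x p => f x * h x p) :=
    (hf.comp measurable_fst).mul hh
  have hG : Measurable (Function.uncurry fun y p => g y * h y p) :=
    (hg.comp measurable_fst).mul hh
  have hGi : Measurable (fun p => ∫⁻ y, g y * h y p ∂m) :=
    Measurable.lintegral_prod_left' hG
  have h1 : ∀ x, ∫⁻ y, f x * g y * ∫⁻ p, h x p * h y p ∂ν ∂m =
      ∫⁻ p, (f x * h x p) * ∫⁻ y, g y * h y p ∂m ∂ν := by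
    intro x
    calc _ = ∫⁻ y, ∫⁻ p, (f x * h x p) * (g y * h y p) ∂ν ∂m := by
          refine lintegral_congr fun y => ?_
          rw [← lintegral_const_mul _ (by fun_prop : Measurable fun p => h x p * h y p)]
          refine lintegral_congr fun p => ?_
          ring
      _ = ∫⁻ p, ∫⁻ y, (f x * h x p) * (g y * h y p) ∂m ∂ν := by
          refine lintegral_lintegral_swap (Measurable.aemeasurable ?_)
          exact (measurable_const.mul ((hhx x).comp measurable_snd)).mul hG
      _ = _ := by
          refine lintegral_congr fun p => ?_
          exact lintegral_const_mul _ (hg.mul (hhp p))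
  simp_rw [h1]
  rw [lintegral_lintegral_swap
    (Measurable.aemeasurable (hF.mul (hGi.comp measurable_snd)))]
  refine lintegral_congr fun p => ?_
  exact lintegral_mul_const _ (hf.mul (hhp p))

lemma aux_cs_s4 {X P : Type*} [MeasurableSpace X] [MeasurableSpace P] (m : Measure X) [SFinite m]
    (ν : Measure P) [SFinite ν] (h : X → P → ℝ≥0∞) (hh : Measurable (Function.uncurry h))
    (f g : X → ℝ≥0∞) (hf : Measurable f) (hg : Measurable g) :
    ∫⁻ x, ∫⁻ y, f x * g y * ∫⁻ p, h x p * h y p ∂ν ∂m ∂m ≤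
      (∫⁻ x, ∫⁻ y, f x * f y * ∫⁻ p, h x p * h y p ∂ν ∂m ∂m) ^ (1 / 2 : ℝ) *
      (∫⁻ x, ∫⁻ y, g x * g y * ∫⁻ p, h x p * h y p ∂ν ∂m ∂m) ^ (1 / 2 : ℝ) := by
  rw [aux_fubini m ν h hh f g hf hg, aux_fubini m ν h hh f f hf hf,
    aux_fubini m ν h hh g g hg hg]
  have hFi : Measurable (fun p => ∫⁻ y, f y * h y p ∂m) :=
    Measurable.lintegral_prod_left' (f := Function.uncurry fun y p => f y * h y p)
      ((hf.comp measurable_fst).mul hh)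
  have hGi : Measurable (fun p => ∫⁻ y, g y * h y p ∂m) :=
    Measurable.lintegral_prod_left' (f := Function.uncurry fun y p => g y * h y p)
      ((hg.comp measurable_fst).mul hh)
  have := ENNReal.lintegral_mul_le_Lp_mul_Lq ν Real.HolderConjugate.two_two
    hFi.aemeasurable hGi.aemeasurable
  simpa [pow_two] using this

lemma aux_gauss (t : ℝ) (ht : 0 < t) (x y : E2) :
    ∫⁻ z : E2, ENNReal.ofReal (exp (-(2 * t) * ‖x - z‖ ^ 2) * exp (-(2 * t) * ‖y - z‖ ^ 2)) =
      ENNReal.ofReal (exp (-t * ‖x - y‖ ^ 2) * (π / (4 * t))) := by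
  have h1 : ∀ z : E2, exp (-(2 * t) * ‖x - z‖ ^ 2) * exp (-(2 * t) * ‖y - z‖ ^ 2) =
      exp (-t * ‖x - y‖ ^ 2) * exp (-(4 * t) * ‖z - (1 / 2 : ℝ) • (x + y)‖ ^ 2) := by
    intro z
    rw [← exp_add, ← exp_add]
    congr 1
    simp only [EuclideanSpace.norm_sq_eq, Fin.sum_univ_two, Real.norm_eq_abs, sq_abs,
      PiLp.sub_apply, PiLp.add_apply, PiLp.smul_apply, smul_eq_mul]
    ring
  have hg : ∫ v : E2, exp (-(4 * t) * ‖v‖ ^ 2) = π / (4 * t) := by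
    rw [GaussianFourier.integral_rexp_neg_mul_sq_norm (by positivity)]
    simp
  have hi : Integrable (fun v : E2 => exp (-(4 * t) * ‖v‖ ^ 2)) := by
    by_contra hc
    rw [integral_undef hc] at hg
    have : 0 < π / (4 * t) := by positivity
    linarith
  simp_rw [h1, ENNReal.ofReal_mul (exp_pos _).le]
  rw [lintegral_const_mul' _ _ ENNReal.ofReal_ne_top,
    lintegral_sub_right_eq_self (fun z : E2 => ENNReal.ofReal (exp (-(4 * t) * ‖z‖ ^ 2))),
    ← ofReal_integral_eq_lintegral_ofReal hi (Filter.Eventually.of_forall fun _ => (exp_pos _).le),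
    hg]

lemma aux_gamma (μ : ℝ) (hμ0 : 0 < μ) (r : ℝ) (hr : 0 < r) :
    ∫⁻ t in Set.Ioi (0 : ℝ), ENNReal.ofReal (t ^ (μ / 2 - 1) * exp (-(r ^ 2 * t))) =
      ENNReal.ofReal (r ^ (-μ) * Gamma (μ / 2)) := by
  have hg := Real.integral_rpow_mul_exp_neg_mul_Ioi (a := μ / 2) (r := r ^ 2)
    (by positivity) (by positivity)
  have he : (1 / r ^ 2) ^ (μ / 2) = r ^ (-μ) := by
    rw [one_div, ← Real.rpow_natCast, ← Real.rpow_neg hr.le, ← Real.rpow_mul hr.le]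
    congr 1
    push_cast
    ring
  rw [he] at hg
  have hG : 0 < Gamma (μ / 2) := Real.Gamma_pos_of_pos (by positivity)
  rw [← hg]
  refine (ofReal_integral_eq_lintegral_ofReal ?_ ?_).symm
  · by_contra hc
    rw [integral_undef hc] at hg
    have : 0 < r ^ (-μ) * Gamma (μ / 2) := by positivity
    linarith
  · refine (ae_restrict_mem measurableSet_Ioi).mono fun t ht => ?_
    have : (0 : ℝ) < t := ht
    simp only [Pi.zero_apply]
    positivity

noncomputable def auxC (μ t : ℝ) : ℝ := t ^ (μ / 2 - 1) * (4 * t / π) / Gamma (μ / 2)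

noncomputable def auxH (μ : ℝ) (x : E2) (p : ℝ × E2) : ℝ≥0∞ :=
  ENNReal.ofReal (√(auxC μ p.1) * exp (-(2 * p.1) * ‖x - p.2‖ ^ 2))

lemma auxH_meas (μ : ℝ) : Measurable (Function.uncurry (auxH μ)) := by
  unfold auxH auxC Function.uncurry
  fun_prop

lemma aux_kernel (μ : ℝ) (hμ0 : 0 < μ) (x y : E2) (hxy : x ≠ y) :
    ∫⁻ p, auxH μ x p * auxH μ y p ∂((volume.restrict (Set.Ioi (0 : ℝ))).prod (volume : Measure E2))
      = ENNReal.ofReal (‖x - y‖ ^ (-μ)) := by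
  have hG : 0 < Gamma (μ / 2) := Real.Gamma_pos_of_pos (by positivity)
  have hm : ∀ x, Measurable (auxH μ x) := fun x => (auxH_meas μ).of_uncurry_left
  have hmm : Measurable fun p => auxH μ x p * auxH μ y p := (hm x).mul (hm y)
  rw [lintegral_prod _ hmm.aemeasurable]
  have h1 : ∀ t ∈ Set.Ioi (0 : ℝ), ∫⁻ z, auxH μ x (t, z) * auxH μ y (t, z) =
      ENNReal.ofReal (1 / Gamma (μ / 2)) *
        ENNReal.ofReal (t ^ (μ / 2 - 1) * exp (-(‖x - y‖ ^ 2 * t))) := by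
    intro t ht
    have ht : 0 < t := ht
    have hC : 0 ≤ auxC μ t := by unfold auxC; positivity
    have h2 : ∀ z, auxH μ x (t, z) * auxH μ y (t, z) = ENNReal.ofReal (auxC μ t) *
        ENNReal.ofReal (exp (-(2 * t) * ‖x - z‖ ^ 2) * exp (-(2 * t) * ‖y - z‖ ^ 2)) := by
      intro z
      unfold auxH
      rw [← ENNReal.ofReal_mul (by positivity), ← ENNReal.ofReal_mul hC]
      congr 1
      simp only
      nth_rewrite 3 [← Real.mul_self_sqrt hC]
      ring
    simp_rw [h2]
    rw [lintegral_const_mul' _ _ ENNReal.ofReal_ne_top, aux_gauss t ht,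
      ← ENNReal.ofReal_mul hC, ← ENNReal.ofReal_mul (by positivity)]
    congr 1
    unfold auxC
    rw [show -t * ‖x - y‖ ^ 2 = -(‖x - y‖ ^ 2 * t) by ring]
    field_simp
  rw [setLIntegral_congr_fun measurableSet_Ioi h1,
    lintegral_const_mul' _ _ ENNReal.ofReal_ne_top,
    aux_gamma μ hμ0 _ (norm_pos_iff.mpr (sub_ne_zero.mpr hxy)),
    ← ENNReal.ofReal_mul (by positivity)]
  congr 1
  field_simp

lemma aux_eq (μ : ℝ) (hμ0 : 0 < μ) (φ ψ : E2 → ℝ) (hφ0 : ∀ x, 0 ≤ φ x) (hψ0 : ∀ x, 0 ≤ ψ x) :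
    (∫⁻ x, ∫⁻ y, ENNReal.ofReal (φ x * ψ y / ‖x - y‖ ^ μ)) =
    ∫⁻ x, ∫⁻ y, ENNReal.ofReal (φ x) * ENNReal.ofReal (ψ y) *
      ∫⁻ p, auxH μ x p * auxH μ y p
        ∂((volume.restrict (Set.Ioi (0 : ℝ))).prod (volume : Measure E2)) := by
  refine lintegral_congr fun x => lintegral_congr_ae ?_
  have : ∀ᵐ y : E2, y ≠ x := by
    rw [ae_iff]; simp
  filter_upwards [this] with y hy
  rw [aux_kernel μ hμ0 x y hy.symm, ← ENNReal.ofReal_mul (hφ0 x),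
    ← ENNReal.ofReal_mul (mul_nonneg (hφ0 x) (hψ0 y)), Real.rpow_neg (norm_nonneg _), div_eq_mul_inv]

/-- Cauchy–Schwarz inequality for the Riesz convolution bilinear form on `ℝ²`,
for nonnegative measurable functions, with integrals in `[0,∞]`. -/
theorem stmt_4 (μ : ℝ) (hμ0 : 0 < μ) (hμ2 : μ < 2)
    (φ ψ : EuclideanSpace ℝ (Fin 2) → ℝ)
    (hφm : Measurable φ) (hψm : Measurable ψ)
    (hφ0 : ∀ x, 0 ≤ φ x) (hψ0 : ∀ x, 0 ≤ ψ x) :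
    (∫⁻ x, ∫⁻ y, ENNReal.ofReal (φ x * ψ y / ‖x - y‖ ^ μ)) ≤
      (∫⁻ x, ∫⁻ y, ENNReal.ofReal (φ x * φ y / ‖x - y‖ ^ μ)) ^ (1 / 2 : ℝ) *
        (∫⁻ x, ∫⁻ y, ENNReal.ofReal (ψ x * ψ y / ‖x - y‖ ^ μ)) ^ (1 / 2 : ℝ) := by
  rw [aux_eq μ hμ0 φ ψ hφ0 hψ0, aux_eq μ hμ0 φ φ hφ0 hφ0, aux_eq μ hμ0 ψ ψ hψ0 hψ0]
  exact aux_cs_s4 volume _ (auxH μ) (auxH_meas μ) (fun x => ENNReal.ofReal (φ x))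
    (fun x => ENNReal.ofReal (ψ x)) hφm.ennreal_ofReal hψm.ennreal_ofReal
end

section
/- For every μ with 0 < μ < 2 and every R > 0, one has ∫_{B_R(0)} ∫_{B_R(0)} |x − y|^{−μ} dy dx ≥ 4π² R^{4−μ} / ( (2 − μ)(3 − μ)(4 − μ) ), where both integrals are over the open ball B_R(0) ⊂ ℝ². -/
open MeasureTheory Real ENNReal

lemma integral_congr_uIoc_aux {a b : ℝ} {f g : ℝ → ℝ} (h : ∀ y ∈ Set.uIoc a b, f y = g y) :
    ∫ y in a..b, f y = ∫ y in a..b, g y :=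
  intervalIntegral.integral_congr_ae (Filter.Eventually.of_forall h)

lemma radial_aux (f : ℝ → ℝ) (r : ℝ) (hr : 0 < r) (hf : ∀ y, 0 ≤ y → y < r → 0 ≤ f y)
    (hi : IntervalIntegrable (fun y => y * f y) volume 0 r) :
    ∫⁻ x in Metric.ball (0 : EuclideanSpace ℝ (Fin 2)) r, ENNReal.ofReal (f ‖x‖)
      = ENNReal.ofReal (2 * π * ∫ y in (0 : ℝ)..r, y * f y) := by
  have h1 : IntegrableOn (fun x : EuclideanSpace ℝ (Fin 2) => f ‖x‖) (Metric.ball 0 r) volume := by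
    rw [integrableOn_fun_norm_addHaar]
    have := (intervalIntegrable_iff_integrableOn_Ioo_of_le hr.le).1 hi
    simpa using this
  have hnn : 0 ≤ᵐ[volume.restrict (Metric.ball (0 : EuclideanSpace ℝ (Fin 2)) r)]
      (fun x => f ‖x‖) := by
    filter_upwards [ae_restrict_mem measurableSet_ball] with x hx
    exact hf _ (norm_nonneg _) (by simpa using hx)
  rw [← ofReal_integral_eq_lintegral_ofReal h1 hnn]
  congr 1
  have h2 : ∫ x in Metric.ball (0 : EuclideanSpace ℝ (Fin 2)) r, f ‖x‖
      = ∫ x : EuclideanSpace ℝ (Fin 2), (Set.Iio r).indicator f ‖x‖ := by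
    rw [← integral_indicator measurableSet_ball]
    congr 1 with x
    simp [Set.indicator]
  have hv : (volume : Measure (EuclideanSpace ℝ (Fin 2))).real (Metric.ball 0 1) = π := by
    rw [Measure.real, EuclideanSpace.volume_ball_fin_two]
    simp [Real.pi_pos.le]
  rw [h2, integral_fun_norm_addHaar, hv]
  have h3 : ∫ y in Set.Ioi (0 : ℝ), y ^ (Module.finrank ℝ (EuclideanSpace ℝ (Fin 2)) - 1) •
      (Set.Iio r).indicator f y = ∫ y in (0 : ℝ)..r, y * f y := by
    rw [intervalIntegral.integral_of_le hr.le, integral_Ioc_eq_integral_Ioo,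
      ← integral_indicator measurableSet_Ioi, ← integral_indicator measurableSet_Ioo]
    congr 1 with y
    by_cases h0 : 0 < y <;> by_cases hr' : y < r <;> simp [Set.indicator, h0, hr']
  rw [h3]
  simp
  ring

lemma inner_aux (μ r : ℝ) (hμ2 : μ < 2) (hr : 0 < r) :
    ∫⁻ x in Metric.ball (0 : EuclideanSpace ℝ (Fin 2)) r, ENNReal.ofReal (‖x‖ ^ (-μ))
      = ENNReal.ofReal (2 * π / (2 - μ) * r ^ (2 - μ)) := by
  have hEq : Set.EqOn (fun y : ℝ => y ^ (1 - μ)) (fun y => y * y ^ (-μ)) (Set.uIoc 0 r) := by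
    intro y hy
    rw [Set.uIoc_of_le hr.le] at hy
    simp only
    rw [sub_eq_add_neg, rpow_add hy.1, Real.rpow_one]
  rw [radial_aux (fun y => y ^ (-μ)) r hr (fun y hy _ => rpow_nonneg hy _)]
  · congr 1
    rw [integral_congr_uIoc_aux (g := fun y : ℝ => y ^ (1 - μ)) (fun y hy => (hEq hy).symm),
      integral_rpow (Or.inl (by linarith)), zero_rpow (by linarith)]
    rw [show 1 - μ + 1 = 2 - μ by ring]
    ring
  · exact (intervalIntegral.intervalIntegrable_rpow' (by linarith)).congr hEq

lemma beta_aux (μ R : ℝ) (hμ2 : μ < 2) (hR : 0 < R) :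
    ∫ y in (0 : ℝ)..R, y * (R - y) ^ (2 - μ) = R ^ (4 - μ) / ((3 - μ) * (4 - μ)) := by
  have h := intervalIntegral.integral_comp_sub_left (a := 0) (b := R)
    (fun u : ℝ => (R - u) * u ^ (2 - μ)) R
  simp only [_root_.sub_sub_cancel, sub_self, sub_zero] at h
  rw [h]
  have e : ∫ u in (0 : ℝ)..R, (R - u) * u ^ (2 - μ)
      = ∫ u in (0 : ℝ)..R, (R * u ^ (2 - μ) - u ^ (3 - μ)) := by
    apply integral_congr_uIoc_aux
    intro y hy
    rw [Set.uIoc_of_le hR.le] at hy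
    rw [show 3 - μ = 1 + (2 - μ) by ring, rpow_add hy.1, Real.rpow_one]
    ring
  rw [e, intervalIntegral.integral_sub
    ((intervalIntegral.intervalIntegrable_rpow' (by linarith)).const_mul _)
    (intervalIntegral.intervalIntegrable_rpow' (by linarith)),
    intervalIntegral.integral_const_mul, integral_rpow (Or.inl (by linarith)),
    integral_rpow (Or.inl (by linarith)), zero_rpow (by linarith), zero_rpow (by linarith),
    show 2 - μ + 1 = 3 - μ by ring, show 3 - μ + 1 = 4 - μ by ring,
    show 4 - μ = 1 + (3 - μ) by ring, rpow_add hR, Real.rpow_one]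
  have h3 : 3 - μ ≠ 0 := by linarith
  have h4 : 1 + (3 - μ) ≠ 0 := by linarith
  field_simp
  ring

/-- For `0 < μ < 2` and `R > 0`, the double integral of `|x − y|^{−μ}` over
`B_R(0) × B_R(0)` is at least `4π² R^{4−μ} / ((2−μ)(3−μ)(4−μ))`. -/
theorem stmt_10 (μ R : ℝ) (hμ0 : 0 < μ) (hμ2 : μ < 2) (hR : 0 < R) :
    ENNReal.ofReal (4 * Real.pi ^ 2 * R ^ (4 - μ) /
        ((2 - μ) * (3 - μ) * (4 - μ))) ≤
      ∫⁻ x in Metric.ball (0 : EuclideanSpace ℝ (Fin 2)) R,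
        ∫⁻ y in Metric.ball (0 : EuclideanSpace ℝ (Fin 2)) R,
          ENNReal.ofReal (‖x - y‖ ^ (-μ)) := by
  have h2 : 0 < 2 - μ := by linarith
  have key : ∫⁻ x in Metric.ball (0 : EuclideanSpace ℝ (Fin 2)) R,
      ENNReal.ofReal (2 * π / (2 - μ) * (R - ‖x‖) ^ (2 - μ)) =
      ENNReal.ofReal (4 * Real.pi ^ 2 * R ^ (4 - μ) / ((2 - μ) * (3 - μ) * (4 - μ))) := by
    rw [radial_aux (fun y => 2 * π / (2 - μ) * (R - y) ^ (2 - μ)) R hR]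
    · congr 1
      have : ∀ y : ℝ, y * (2 * π / (2 - μ) * (R - y) ^ (2 - μ))
          = 2 * π / (2 - μ) * (y * (R - y) ^ (2 - μ)) := fun y => by ring
      simp_rw [this]
      rw [intervalIntegral.integral_const_mul, beta_aux μ R hμ2 hR]
      have h3 : 3 - μ ≠ 0 := by linarith
      have h4 : 4 - μ ≠ 0 := by linarith
      field_simp
      ring
    · intro y _ hy
      have : 0 ≤ R - y := by linarith
      positivity
    · apply Continuous.intervalIntegrable
      have : Continuous fun y : ℝ => (R - y) ^ (2 - μ) :=
        (continuous_const.sub continuous_id).rpow_const (fun _ => Or.inr h2.le)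
      fun_prop
  rw [← key]
  apply setLIntegral_mono' measurableSet_ball
  intro x hx
  have hx' : ‖x‖ < R := by simpa using hx
  rw [← inner_aux μ (R - ‖x‖) hμ2 (by linarith)]
  rw [← lintegral_indicator measurableSet_ball, ← lintegral_indicator measurableSet_ball,
    ← lintegral_sub_left_eq_self _ x]
  apply lintegral_mono
  intro y
  simp only [Set.indicator, mem_ball_zero_iff]
  split_ifs with h h'
  · exact le_rfl
  · exfalso
    apply h'
    have := norm_sub_norm_le y x
    rw [norm_sub_rev] at this
    linarith
  · exact bot_le
  · exact le_rfl
end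

section
/- Let f : ℝ → ℝ be continuous with f(t) = 0 for t ≤ 0, let F(t) = ∫₀^t f(τ) dτ, let θ > 0, and assume t f(t) ≥ θ F(t) ≥ 0 for all t > 0. Then the map t ↦ F(t)/t^θ is nondecreasing on (0, ∞); in particular F(λ t) ≥ λ^θ F(t) for all t > 0 and λ ≥ 1, and F(λ t) ≤ λ^θ F(t) for all t > 0 and 0 < λ ≤ 1. -/
open Real intervalIntegral

/-- If `f` is continuous, vanishes on `(-∞,0]`, `F(t) = ∫₀^t f`, `θ > 0` and
`t f(t) ≥ θ F(t) ≥ 0` for `t > 0`, then `t ↦ F(t)/t^θ` is nondecreasing on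
`(0,∞)`; in particular `F(λt) ≥ λ^θ F(t)` for `λ ≥ 1` and
`F(λt) ≤ λ^θ F(t)` for `0 < λ ≤ 1`. -/
theorem stmt_13 (f : ℝ → ℝ) (hf : Continuous f) (hf0 : ∀ t : ℝ, t ≤ 0 → f t = 0)
    (F : ℝ → ℝ) (hF : ∀ t : ℝ, F t = ∫ τ in (0 : ℝ)..t, f τ)
    (θ : ℝ) (hθ : 0 < θ)
    (hAR : ∀ t : ℝ, 0 < t → θ * F t ≤ t * f t ∧ 0 ≤ θ * F t) :
    MonotoneOn (fun t => F t / t ^ θ) (Set.Ioi (0 : ℝ)) ∧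
      (∀ t : ℝ, 0 < t → ∀ lam : ℝ, 1 ≤ lam → lam ^ θ * F t ≤ F (lam * t)) ∧
      (∀ t : ℝ, 0 < t → ∀ lam : ℝ, 0 < lam → lam ≤ 1 →
        F (lam * t) ≤ lam ^ θ * F t) := by
  have hd : ∀ t : ℝ, HasDerivAt F (f t) t := by
    have : F = fun t => ∫ τ in (0 : ℝ)..t, f τ := funext hF
    intro t
    rw [this]
    exact intervalIntegral.integral_hasDerivAt_right (hf.intervalIntegrable _ _)
      (hf.stronglyMeasurableAtFilter _ _) hf.continuousAt
  have hg : ∀ t : ℝ, 0 < t → HasDerivAt (fun t => F t / t ^ θ)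
      ((f t * t ^ θ - F t * (θ * t ^ (θ - 1))) / (t ^ θ) ^ 2) t := fun t ht =>
    (hd t).div (Real.hasDerivAt_rpow_const (Or.inl ht.ne')) (Real.rpow_pos_of_pos ht θ).ne'
  have hm : MonotoneOn (fun t => F t / t ^ θ) (Set.Ioi (0 : ℝ)) := by
    apply monotoneOn_of_deriv_nonneg (convex_Ioi 0)
    · exact fun t ht => (hg t ht).continuousAt.continuousWithinAt
    · rw [interior_Ioi]
      exact fun t ht => (hg t ht).differentiableAt.differentiableWithinAt
    · rw [interior_Ioi]
      intro t ht
      have ht' : 0 < t := ht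
      rw [(hg t ht).deriv]
      apply div_nonneg _ (sq_nonneg _)
      have h1 : t ^ θ = t ^ (θ - 1) * t := by
        rw [← Real.rpow_add_one ht'.ne']
        ring_nf
      have h2 := mul_nonneg (Real.rpow_pos_of_pos ht' (θ - 1)).le
        (sub_nonneg.2 (hAR t ht).1)
      rw [h1]
      nlinarith
  refine ⟨hm, ?_, ?_⟩
  · intro t ht lam hl
    have hl0 : 0 < lam := by linarith
    have h := hm (Set.mem_Ioi.2 ht) (Set.mem_Ioi.2 (mul_pos hl0 ht)) (by nlinarith)
    simp only at h
    have hp := Real.rpow_pos_of_pos ht θ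
    have hq := Real.rpow_pos_of_pos hl0 θ
    rw [Real.mul_rpow hl0.le ht.le, div_le_div_iff₀ hp (mul_pos hq hp)] at h
    refine le_of_mul_le_mul_right ?_ hp
    linarith
  · intro t ht lam hl0 hl
    have h := hm (Set.mem_Ioi.2 (mul_pos hl0 ht)) (Set.mem_Ioi.2 ht) (by nlinarith)
    simp only at h
    have hp := Real.rpow_pos_of_pos ht θ
    have hq := Real.rpow_pos_of_pos hl0 θ
    rw [Real.mul_rpow hl0.le ht.le, div_le_div_iff₀ (mul_pos hq hp) hp] at h
    refine le_of_mul_le_mul_right ?_ hp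
    linarith
end

section
/- Let f : ℝ → ℝ be continuous with f(t) = 0 for t ≤ 0, let F(t) = ∫₀^t f(τ) dτ, let θ > 1, and assume t f(t) ≥ θ F(t) ≥ 0 for all t > 0. If 0 < t₁ < t₂ and F(t₁) > 0, then F(t₂)/t₂ > F(t₁)/t₁. -/
open Real intervalIntegral

/-- If `f` is continuous, vanishes on `(-∞,0]`, `F(t) = ∫₀^t f`, `θ > 1` and
`t f(t) ≥ θ F(t) ≥ 0` for `t > 0`, then `F(t)/t` is strictly increasing
between points where `F` is positive: `0 < t₁ < t₂` and `F(t₁) > 0` imply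
`F(t₂)/t₂ > F(t₁)/t₁`. -/
theorem stmt_14 (f : ℝ → ℝ) (hf : Continuous f) (hf0 : ∀ t : ℝ, t ≤ 0 → f t = 0)
    (F : ℝ → ℝ) (hF : ∀ t : ℝ, F t = ∫ τ in (0 : ℝ)..t, f τ)
    (θ : ℝ) (hθ : 1 < θ)
    (hAR : ∀ t : ℝ, 0 < t → θ * F t ≤ t * f t ∧ 0 ≤ θ * F t)
    (t₁ t₂ : ℝ) (ht₁ : 0 < t₁) (ht₁₂ : t₁ < t₂) (hFt₁ : 0 < F t₁) :
    F t₁ / t₁ < F t₂ / t₂ := by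
  have hd : ∀ t : ℝ, HasDerivAt F (f t) t := by
    intro t
    have hFe : F = fun t => ∫ τ in (0 : ℝ)..t, f τ := funext hF
    rw [hFe]
    exact integral_hasDerivAt_right (hf.intervalIntegrable 0 t)
      (hf.stronglyMeasurableAtFilter _ _) hf.continuousAt
  have hFc : Continuous F := continuous_iff_continuousAt.2 fun t => (hd t).continuousAt
  have hfn : ∀ t : ℝ, 0 < t → 0 ≤ f t := by
    intro t ht
    obtain ⟨h1, h2⟩ := hAR t ht
    exact nonneg_of_mul_nonneg_right (h2.trans h1) ht
  have hmono : MonotoneOn F (Set.Icc t₁ t₂) := by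
    apply monotoneOn_of_deriv_nonneg (convex_Icc _ _) hFc.continuousOn
    · exact fun t _ => (hd t).differentiableAt.differentiableWithinAt
    · intro t ht
      rw [interior_Icc] at ht
      rw [(hd t).deriv]
      exact hfn t (ht₁.trans ht.1)
  have hs : StrictMonoOn (fun t => F t / t) (Set.Icc t₁ t₂) := by
    apply strictMonoOn_of_deriv_pos (convex_Icc _ _)
    · exact hFc.continuousOn.div continuousOn_id fun t ht => (ht₁.trans_le ht.1).ne'
    · intro t ht
      rw [interior_Icc] at ht
      have ht0 : 0 < t := ht₁.trans ht.1
      have hpos : 0 < F t := hFt₁.trans_le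
        (hmono ⟨le_rfl, ht₁₂.le⟩ ⟨ht.1.le, ht.2.le⟩ ht.1.le)
      have hq : HasDerivAt (fun t => F t / t) ((f t * t - F t * 1) / t ^ 2) t :=
        (hd t).div (hasDerivAt_id t) ht0.ne'
      rw [hq.deriv]
      have h1 := (hAR t ht0).1
      apply div_pos _ (by positivity)
      nlinarith [mul_pos (sub_pos.2 hθ) hpos]
  exact hs ⟨le_rfl, ht₁₂.le⟩ ⟨ht₁₂.le, le_rfl⟩ ht₁₂
end

section
/- Let f : ℝ → ℝ be continuous with f(t) = 0 for t ≤ 0, let F(t) = ∫₀^t f(τ) dτ, assume f is nondecreasing on (0, ∞) and t f(t) ≥ F(t) ≥ 0 for all t > 0. Then for all t ≥ 1 and all a, b > 0: F(t a) · f(t b) · t b ≥ t² · F(a) · f(b) · b. -/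
open Real intervalIntegral

/-- If `f` is continuous, vanishes on `(-∞,0]`, is nondecreasing on `(0,∞)`,
`F(t) = ∫₀^t f` and `t f(t) ≥ F(t) ≥ 0` for `t > 0`, then for `t ≥ 1` and
`a, b > 0`: `F(ta) f(tb) tb ≥ t² F(a) f(b) b`. -/
theorem stmt_15 (f : ℝ → ℝ) (hf : Continuous f) (hf0 : ∀ t : ℝ, t ≤ 0 → f t = 0)
    (F : ℝ → ℝ) (hF : ∀ t : ℝ, F t = ∫ τ in (0 : ℝ)..t, f τ)
    (hmono : MonotoneOn f (Set.Ioi (0 : ℝ)))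
    (hAR : ∀ t : ℝ, 0 < t → F t ≤ t * f t ∧ 0 ≤ F t) :
    ∀ t : ℝ, 1 ≤ t → ∀ a b : ℝ, 0 < a → 0 < b →
      t ^ 2 * (F a * f b * b) ≤ F (t * a) * f (t * b) * (t * b) := by
  intro t ht a b ha hb
  have ht0 : 0 < t := by linarith
  have hle : ∀ x : ℝ, 0 ≤ x → f x ≤ f (t * x) := by
    intro x hx
    rcases hx.eq_or_lt with h | h
    · rw [← h, mul_zero]
    · exact hmono h (Set.mem_Ioi.2 (mul_pos ht0 h)) (by nlinarith)
  have hFt : t * F a ≤ F (t * a) := by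
    have h1 : F (t * a) = t * ∫ x in (0 : ℝ)..a, f (t * x) := by
      rw [hF, intervalIntegral.mul_integral_comp_mul_left, mul_zero]
    rw [h1, hF a]
    apply mul_le_mul_of_nonneg_left _ ht0.le
    apply intervalIntegral.integral_mono_on ha.le (hf.intervalIntegrable _ _)
      ((hf.comp (continuous_const.mul continuous_id)).intervalIntegrable _ _)
    intro x hx
    exact hle x hx.1
  have hFa := (hAR a ha).2
  have hfb : 0 ≤ f b := by
    have h := hAR b hb
    exact nonneg_of_mul_nonneg_right (h.2.trans h.1) hb
  have hFta : 0 ≤ F (t * a) := (hAR _ (mul_pos ht0 ha)).2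
  have key : (t * F a) * f b ≤ F (t * a) * f (t * b) :=
    mul_le_mul hFt (hle b hb.le) hfb hFta
  calc t ^ 2 * (F a * f b * b) = (t * F a) * f b * (t * b) := by ring
    _ ≤ _ := mul_le_mul_of_nonneg_right key (mul_pos ht0 hb).le
end

section
/- Let 0 < μ < 2 and let f : ℝ → ℝ be continuous with f(t) = 0 for t ≤ 0, satisfying lim_{t→0⁺} f(t)/t^{(2−μ)/2} = 0 and lim_{t→+∞} f(t) e^{−α t²} = 0 for every α > 4π. Let F(t) = ∫₀^t f(τ) dτ. Then for every η > 0, every q > 1 and every k > 1 there exists a constant C > 0 such that for all t ≥ 0: |F(t)| ≤ η t^{(4−μ)/2} + C t^q ( e^{4π k t²} − 1 ). -/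
open Real Filter intervalIntegral

/-- Growth estimate on the primitive `F` of a nonlinearity `f` with critical
exponential growth: for every `η > 0`, `q > 1`, `k > 1` there is `C > 0` with
`|F(t)| ≤ η t^{(4−μ)/2} + C t^q (e^{4πk t²} − 1)` for all `t ≥ 0`. -/
theorem stmt_19 (μ : ℝ) (hμ0 : 0 < μ) (hμ2 : μ < 2)
    (f : ℝ → ℝ) (hf : Continuous f) (hf0 : ∀ t : ℝ, t ≤ 0 → f t = 0)
    (hf1 : Tendsto (fun t => f t / t ^ ((2 - μ) / 2))
      (nhdsWithin 0 (Set.Ioi (0 : ℝ))) (nhds 0))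
    (hf2 : ∀ α : ℝ, 4 * Real.pi < α →
      Tendsto (fun t => f t * Real.exp (-(α * t ^ 2))) atTop (nhds 0))
    (F : ℝ → ℝ) (hF : ∀ t : ℝ, F t = ∫ τ in (0 : ℝ)..t, f τ) :
    ∀ η : ℝ, 0 < η → ∀ q : ℝ, 1 < q → ∀ k : ℝ, 1 < k →
      ∃ C : ℝ, 0 < C ∧ ∀ t : ℝ, 0 ≤ t →
        |F t| ≤ η * t ^ ((4 - μ) / 2) +
          C * t ^ q * (Real.exp (4 * Real.pi * k * t ^ 2) - 1) := by
  intro η hη q hq k hk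
  set α : ℝ := 4 * Real.pi * k with hα
  have hpi := Real.pi_pos
  have hαpi : 4 * Real.pi < α := by rw [hα]; nlinarith
  have hα0 : 0 < α := by linarith
  -- bound near zero
  obtain ⟨δ, hδ0, hδ⟩ : ∃ δ : ℝ, 0 < δ ∧ ∀ t, 0 < t → t < δ →
      |f t| ≤ η * t ^ ((2 - μ) / 2) := by
    have h1 := (Metric.tendsto_nhdsWithin_nhds.1 hf1) η hη
    obtain ⟨δ, hδ0, h⟩ := h1
    refine ⟨δ, hδ0, fun t ht htδ => ?_⟩
    have h2 := h (x := t) ht (by rw [Real.dist_eq, sub_zero, abs_of_pos ht]; exact htδ)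
    have hp : 0 < t ^ ((2 - μ) / 2) := Real.rpow_pos_of_pos ht _
    rw [Real.dist_eq, sub_zero, abs_div, abs_of_pos hp, div_lt_iff₀ hp] at h2
    exact h2.le
  -- global bound
  obtain ⟨M, hM0, hM⟩ : ∃ M : ℝ, 0 < M ∧ ∀ t, 0 ≤ t → |f t| ≤ M * Real.exp (α * t ^ 2) := by
    have h1 := (Metric.tendsto_atTop.1 (hf2 α hαpi)) 1 one_pos
    obtain ⟨T, hT⟩ := h1
    obtain ⟨B, hB⟩ := (isCompact_Icc (a := (0 : ℝ)) (b := T)).exists_bound_of_continuousOn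
      hf.continuousOn
    refine ⟨max B 1, lt_of_lt_of_le one_pos (le_max_right _ _), fun t ht => ?_⟩
    have he : 1 ≤ Real.exp (α * t ^ 2) := Real.one_le_exp (by positivity)
    rcases le_total t T with h | h
    · have h2 := hB t ⟨ht, h⟩
      rw [Real.norm_eq_abs] at h2
      have h3 : B ≤ max B 1 := le_max_left _ _
      have h4 : (1 : ℝ) ≤ max B 1 := le_max_right _ _
      nlinarith
    · have h2 := hT t h
      rw [Real.dist_eq, sub_zero, abs_mul, abs_of_pos (Real.exp_pos _), Real.exp_neg,
        ← div_eq_mul_inv, div_lt_iff₀ (Real.exp_pos _)] at h2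
      have h4 : (1 : ℝ) ≤ max B 1 := le_max_right _ _
      nlinarith
  have hE : Real.exp (-(α * δ ^ 2)) < 1 := by
    rw [Real.exp_lt_one_iff]
    have : 0 < α * δ ^ 2 := by positivity
    linarith
  have hD : 0 < δ ^ (q - 1) * (1 - Real.exp (-(α * δ ^ 2))) :=
    mul_pos (Real.rpow_pos_of_pos hδ0 _) (by linarith)
  refine ⟨M / (δ ^ (q - 1) * (1 - Real.exp (-(α * δ ^ 2)))), div_pos hM0 hD, fun t ht => ?_⟩
  have hbound : ∀ K : ℝ, (∀ x, 0 < x → x ≤ t → |f x| ≤ K) → |F t| ≤ K * t := by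
    intro K hK
    have := intervalIntegral.norm_integral_le_of_norm_le_const (a := (0 : ℝ)) (b := t) (f := f)
      (C := K) (fun x hx => by
        rw [Set.uIoc_of_le ht] at hx
        exact hK x hx.1 hx.2)
    rw [sub_zero, abs_of_nonneg ht, Real.norm_eq_abs, ← hF] at this
    exact this
  have hexp1 : 1 ≤ Real.exp (α * t ^ 2) := Real.one_le_exp (by positivity)
  rcases lt_or_ge t δ with h | h
  · have h1 := hbound (η * t ^ ((2 - μ) / 2)) (fun x hx hxt =>
      (hδ x hx (lt_of_le_of_lt hxt h)).trans
        (mul_le_mul_of_nonneg_left (Real.rpow_le_rpow hx.le hxt (by linarith)) hη.le))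
    have h2 : t ^ ((4 - μ) / 2) = t ^ ((2 - μ) / 2) * t := by
      rw [← Real.rpow_add_one' ht (by linarith)]
      congr 1; ring
    have h3 : 0 ≤ M / (δ ^ (q - 1) * (1 - Real.exp (-(α * δ ^ 2)))) * t ^ q *
        (Real.exp (α * t ^ 2) - 1) :=
      mul_nonneg (mul_nonneg (div_pos hM0 hD).le (Real.rpow_nonneg ht _)) (by linarith)
    rw [h2]
    linarith
  · have ht0 : 0 < t := lt_of_lt_of_le hδ0 h
    have h1 := hbound (M * Real.exp (α * t ^ 2)) (fun x hx hxt =>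
      (hM x hx.le).trans (mul_le_mul_of_nonneg_left (Real.exp_le_exp.2
        (mul_le_mul_of_nonneg_left (pow_le_pow_left₀ hx.le hxt 2) hα0.le)) hM0.le))
    have h2 : t ^ q = t ^ (q - 1) * t := by
      rw [← Real.rpow_add_one ht0.ne']
      congr 1; ring
    have h3 : δ ^ (q - 1) ≤ t ^ (q - 1) := Real.rpow_le_rpow hδ0.le h (by linarith)
    have h4 : (1 - Real.exp (-(α * δ ^ 2))) * Real.exp (α * t ^ 2) ≤
        Real.exp (α * t ^ 2) - 1 := by
      have h5 : 1 ≤ Real.exp (-(α * δ ^ 2)) * Real.exp (α * t ^ 2) := by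
        rw [← Real.exp_add]
        apply Real.one_le_exp
        have := mul_le_mul_of_nonneg_left (pow_le_pow_left₀ hδ0.le h 2) hα0.le
        linarith
      linarith
    have h6 : 0 ≤ η * t ^ ((4 - μ) / 2) := mul_nonneg hη.le (Real.rpow_nonneg ht _)
    have h7 : M * Real.exp (α * t ^ 2) * t ≤ M / (δ ^ (q - 1) * (1 - Real.exp (-(α * δ ^ 2)))) *
        t ^ q * (Real.exp (α * t ^ 2) - 1) := by
      rw [h2, div_mul_eq_mul_div, div_mul_eq_mul_div, le_div_iff₀ hD]
      have h8 := mul_le_mul h3 h4 (mul_nonneg (by linarith) (by linarith))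
        (Real.rpow_nonneg ht _)
      have h9 := mul_le_mul_of_nonneg_left h8 (mul_pos hM0 ht0).le
      calc _ = M * t * (δ ^ (q - 1) * ((1 - Real.exp (-(α * δ ^ 2))) *
            Real.exp (α * t ^ 2))) := by ring
        _ ≤ _ := h9
        _ = _ := by ring
    linarith
end
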